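/- Let X_1,...,X_n (n ≥ 2) be i.i.d. uniform points on the unit sphere S² ⊂ ℝ³ and S_{n,3} = conv{±X_1,...,±X_n} their symmetric convex hull. Then E[Vol₃(S_{n,3})] = (4π/3)·n(n-2)/((n+1)(n+3)). -/

import Mathlib

open MeasureTheory

section

open Set Filter Topology
open scoped ENNReal NNReal

/-- Three-dimensional Euclidean space. -/
abbrev E3 := EuclideanSpace ℝ (Fin 3)

/-- Spherical coordinates with longitude `p.1` and colatitude `p.2`. -/
noncomputable def sphericalParam (p : ℝ × ℝ) : E3 :=
  !₂[Real.sin p.2 * Real.cos p.1, Real.sin p.2 * Real.sin p.1, Real.cos p.2]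

theorem norm_sq_eq_coords (x : E3) : ‖x‖ ^ 2 = x 0 ^ 2 + x 1 ^ 2 + x 2 ^ 2 := by
  simp [EuclideanSpace.norm_sq_eq, Fin.sum_univ_three]

theorem sphere_subset_image_sphericalParam :
    Metric.sphere (0 : E3) 1 ⊆
      sphericalParam '' (Icc (-Real.pi) Real.pi ×ˢ Icc 0 Real.pi) := by
  intro x hx
  have hx1 : x 0 ^ 2 + x 1 ^ 2 + x 2 ^ 2 = 1 := by
    rw [← norm_sq_eq_coords, mem_sphere_zero_iff_norm.1 hx]; norm_num
  set z : ℂ := ⟨x 0, x 1⟩ with hz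
  have hx2 : -1 ≤ x 2 ∧ x 2 ≤ 1 := by
    constructor <;> nlinarith [sq_nonneg (x 0), sq_nonneg (x 1)]
  have hs : Real.sin (Real.arccos (x 2)) = ‖z‖ := by
    rw [Real.sin_arccos, Complex.norm_eq_sqrt_sq_add_sq]
    congr 1
    simp only [hz]
    linarith
  refine ⟨(Complex.arg z, Real.arccos (x 2)), ⟨⟨(Complex.neg_pi_lt_arg z).le,
    Complex.arg_le_pi z⟩, Real.arccos_nonneg _, Real.arccos_le_pi _⟩, ?_⟩
  ext i
  fin_cases i
  · simp [sphericalParam, hs, hz]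
  · simp [sphericalParam, hs, hz]
  · simpa [sphericalParam] using Real.cos_arccos hx2.1 hx2.2

theorem hausdorffMeasure_sphere_lt_top : μH[2] (Metric.sphere (0 : E3) 1) < ∞ := by
  have hc : ContDiff ℝ 1 sphericalParam := by
    rw [contDiff_euclidean]
    intro i
    fin_cases i <;> simp [sphericalParam] <;> fun_prop
  have hK : IsCompact (Icc (-Real.pi) Real.pi ×ˢ Icc 0 Real.pi : Set (ℝ × ℝ)) :=
    isCompact_Icc.prod isCompact_Icc
  obtain ⟨K, hKL⟩ := LocallyLipschitzOn.exists_lipschitzOnWith_of_compact hK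
    (hc.locallyLipschitz.locallyLipschitzOn (s := _))
  calc μH[2] (Metric.sphere (0 : E3) 1)
      ≤ μH[2] (sphericalParam '' (Icc (-Real.pi) Real.pi ×ˢ Icc 0 Real.pi)) :=
        measure_mono sphere_subset_image_sphericalParam
    _ ≤ (K : ℝ≥0∞) ^ (2 : ℝ) * μH[2] (Icc (-Real.pi) Real.pi ×ˢ Icc 0 Real.pi : Set (ℝ × ℝ)) :=
        hKL.hausdorffMeasure_image_le (by norm_num)
    _ < ∞ := by
        rw [hausdorffMeasure_prod_real]
        exact ENNReal.mul_lt_top (ENNReal.rpow_lt_top_of_nonneg (by norm_num) (by simp))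
          hK.measure_lt_top

theorem hausdorffMeasure_sphere_pos : 0 < μH[2] (Metric.sphere (0 : E3) 1) := by
  set f : E3 → ℝ × ℝ := fun x => (x 0, x 1)
  have hf : LipschitzWith 1 f := by
    refine LipschitzWith.of_dist_le_mul fun x y => ?_
    simp only [f, Prod.dist_eq, NNReal.coe_one, one_mul]
    exact max_le (by simpa [Real.dist_eq, dist_eq_norm] using PiLp.norm_apply_le (x - y) 0)
      (by simpa [Real.dist_eq, dist_eq_norm] using PiLp.norm_apply_le (x - y) 1)
  have hsub : Icc (0 : ℝ) (1 / 2) ×ˢ Icc (0 : ℝ) (1 / 2) ⊆ f '' Metric.sphere (0 : E3) 1 := by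
    rintro ⟨a, b⟩ ⟨⟨ha0, ha1⟩, hb0, hb1⟩
    simp only at ha0 ha1 hb0 hb1
    refine ⟨!₂[a, b, √(1 - a ^ 2 - b ^ 2)], ?_, by simp [f]⟩
    have h0 : 0 ≤ 1 - a ^ 2 - b ^ 2 := by nlinarith
    rw [mem_sphere_zero_iff_norm, ← sq_eq_sq₀ (norm_nonneg _) zero_le_one, norm_sq_eq_coords]
    simp [Real.sq_sqrt h0]
  have h1 := hf.hausdorffMeasure_image_le (d := 2) (by norm_num) (Metric.sphere (0 : E3) 1)
  have h2 := measure_mono (μ := μH[2]) hsub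
  have h3 : 0 < μH[2] (Icc (0 : ℝ) (1 / 2) ×ˢ Icc (0 : ℝ) (1 / 2)) := by
    rw [hausdorffMeasure_prod_real, Measure.volume_eq_prod, Measure.prod_prod]
    norm_num
  simp only [ENNReal.coe_one, ENNReal.one_rpow, one_mul] at h1
  exact h3.trans_le (h2.trans h1)

/-- The uniform probability measure on the unit sphere of `E3`. -/
noncomputable def sphereUniform : Measure E3 :=
  ((μH[2] : Measure E3).restrict (Metric.sphere 0 1) univ)⁻¹ •
    (μH[2] : Measure E3).restrict (Metric.sphere 0 1)

instance : IsProbabilityMeasure sphereUniform := by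
  constructor
  simp only [sphereUniform, Measure.smul_apply, smul_eq_mul, Measure.restrict_apply_univ]
  exact ENNReal.inv_mul_cancel hausdorffMeasure_sphere_pos.ne' hausdorffMeasure_sphere_lt_top.ne

theorem ae_norm_eq_one_sphereUniform : ∀ᵐ x ∂sphereUniform, ‖x‖ = 1 := by
  refine Measure.ae_smul_measure ?_ _
  filter_upwards [ae_restrict_mem Metric.isClosed_sphere.measurableSet] with x hx
  exact mem_sphere_zero_iff_norm.1 hx

theorem measurePreserving_sphereUniform (R : E3 ≃ₗᵢ[ℝ] E3) :
    MeasurePreserving R sphereUniform sphereUniform := by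
  refine MeasurePreserving.smul_measure ?_ _
  have h := (R.toIsometryEquiv.measurePreserving_hausdorffMeasure 2).restrict_preimage
    (s := Metric.sphere (0 : E3) 1) Metric.isClosed_sphere.measurableSet
  have h2 : R.toIsometryEquiv ⁻¹' Metric.sphere (0 : E3) 1 = Metric.sphere 0 1 := by
    ext x; simp
  rwa [h2] at h

theorem exists_linearIsometryEquiv_apply_eq {v w : E3} (h : ‖v‖ = ‖w‖) :
    ∃ R : E3 ≃ₗᵢ[ℝ] E3, R v = w :=
  ⟨_, Submodule.reflection_sub h⟩

/-- A rotation invariant probability measure on the unit sphere is unique. -/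
theorem eq_of_rotation_invariant {μ ν : Measure E3} [IsProbabilityMeasure μ]
    [IsProbabilityMeasure ν] (hμ : ∀ R : E3 ≃ₗᵢ[ℝ] E3, MeasurePreserving R μ μ)
    (hν : ∀ R : E3 ≃ₗᵢ[ℝ] E3, MeasurePreserving R ν ν)
    (hμ1 : ∀ᵐ x ∂μ, ‖x‖ = 1) (hν1 : ∀ᵐ x ∂ν, ‖x‖ = 1) : μ = ν := by
  have inv : ∀ {ρ : Measure E3}, (∀ R : E3 ≃ₗᵢ[ℝ] E3, MeasurePreserving R ρ ρ) →
      ∀ {v w : E3}, ‖v‖ = ‖w‖ → charFun ρ v = charFun ρ w := by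
    intro ρ hρ v w hvw
    obtain ⟨R, rfl⟩ := exists_linearIsometryEquiv_apply_eq hvw
    have h := (hρ R).integral_comp R.toHomeomorph.measurableEmbedding
      (fun x => Complex.exp ((inner ℝ x (R v) : ℝ) * Complex.I))
    simpa [charFun_apply] using h
  have key : ∀ {ρ τ : Measure E3} [IsProbabilityMeasure ρ] [IsProbabilityMeasure τ],
      (∀ R : E3 ≃ₗᵢ[ℝ] E3, MeasurePreserving R ρ ρ) → (∀ᵐ x ∂τ, ‖x‖ = 1) → ∀ t : E3,
      ∫ y, ∫ x, Complex.exp (‖t‖ * (inner ℝ x y : ℝ) * Complex.I) ∂ρ ∂τ = charFun ρ t := by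
    intro ρ τ _ _ hρ hτ t
    have : ∀ᵐ y ∂τ, ∫ x, Complex.exp (‖t‖ * (inner ℝ x y : ℝ) * Complex.I) ∂ρ
        = charFun ρ t := by
      filter_upwards [hτ] with y hy
      rw [inv hρ (v := t) (w := ‖t‖ • y) (by simp [norm_smul, hy]), charFun_apply]
      simp [inner_smul_right]
    rw [integral_congr_ae this]
    simp
  apply Measure.ext_of_charFun
  ext t
  rw [← key (τ := ν) hμ hν1 t, ← key (τ := μ) hν hμ1 t, integral_integral_swap]
  · simp_rw [real_inner_comm]
  · refine Integrable.of_bound (C := 1) ?_ (Eventually.of_forall fun z => ?_)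
    · apply Continuous.aestronglyMeasurable
      simp only [Function.uncurry_def]
      fun_prop
    · simp only [Function.uncurry_def]
      rw [← Complex.ofReal_mul, Complex.norm_exp_ofReal_mul_I]

theorem lintegral_pi_fin_three {α : Type*} [MeasurableSpace α] (μ : Measure α) [SigmaFinite μ]
    {F : (Fin 3 → α) → ℝ≥0∞} (hF : Measurable F) :
    ∫⁻ v, F v ∂(Measure.pi fun _ => μ) = ∫⁻ a, ∫⁻ b, ∫⁻ c, F ![a, b, c] ∂μ ∂μ ∂μ := by
  have h3 := (measurePreserving_piFinSuccAbove (fun _ : Fin 3 => μ) 0).symm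
  have hF3 : AEMeasurable (fun z => F ((MeasurableEquiv.piFinSuccAbove (fun _ : Fin 3 => α) 0).symm
      z)) (μ.prod (Measure.pi fun _ : Fin 2 => μ)) := (hF.comp h3.measurable).aemeasurable
  rw [← h3.lintegral_comp hF, lintegral_prod _ hF3]
  refine lintegral_congr fun a => ?_
  have h2 := (measurePreserving_finTwoArrow μ).symm
  have hFa := (hF.comp h3.measurable).comp (measurable_prodMk_left (x := a))
  have := h2.lintegral_comp hFa
  simp only [Function.comp_apply] at this hFa
  have hm : AEMeasurable (fun z => F ((MeasurableEquiv.piFinSuccAbove (fun _ : Fin 3 => α) 0).symm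
      (a, MeasurableEquiv.finTwoArrow.symm z))) (μ.prod μ) := (hFa.comp h2.measurable).aemeasurable
  rw [lintegral_prod _ hm] at this
  refine this.symm.trans ?_
  refine lintegral_congr fun b => lintegral_congr fun c => ?_
  congr 1
  ext i
  fin_cases i <;> rfl

theorem measurable_vec3 : Measurable fun p : ℝ × ℝ × ℝ => (!₂[p.1, p.2.1, p.2.2] : E3) := by
  refine (WithLp.measurable_toLp 2 _).comp (measurable_pi_lambda _ fun i => ?_)
  fin_cases i <;> simp <;> fun_prop

theorem lintegral_E3 {F : E3 → ℝ≥0∞} (hF : Measurable F) :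
    ∫⁻ x, F x = ∫⁻ a, ∫⁻ b, ∫⁻ c, F !₂[a, b, c] := by
  have h := (EuclideanSpace.volume_preserving_symm_measurableEquiv_toLp (Fin 3)).symm
  rw [← h.lintegral_comp hF, volume_pi]
  exact lintegral_pi_fin_three _ (hF.comp h.measurable)

theorem lintegral_eq_mul_comp_mul_left (G : ℝ → ℝ≥0∞) {p : ℝ} (hp : p ≠ 0) :
    ∫⁻ a, G a = ENNReal.ofReal |p| * ∫⁻ s, G (p * s) := by
  conv_lhs => rw [← Real.smul_map_volume_mul_left hp]
  rw [lintegral_smul_measure, smul_eq_mul]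
  congr 1
  exact (Homeomorph.mulLeft₀ p hp).measurableEmbedding.lintegral_map _

/-- The substitution `c = (ρ / p - p) / 2`. -/
theorem lintegral_eq_lintegral_Ioi_sub (G : ℝ → ℝ≥0∞) {ρ : ℝ} (hρ : 0 < ρ) :
    ∫⁻ c, G c =
      ∫⁻ p in Ioi (0 : ℝ), ENNReal.ofReal ((ρ / p ^ 2 + 1) / 2) * G ((ρ / p - p) / 2) := by
  have himg : (fun p : ℝ => (ρ / p - p) / 2) '' Ioi 0 = univ := by
    refine eq_univ_of_forall fun c => ?_
    have h1 : √(c ^ 2 + ρ) ^ 2 = c ^ 2 + ρ := Real.sq_sqrt (by positivity)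
    have h2 : |c| < √(c ^ 2 + ρ) := by
      rw [← Real.sqrt_sq_eq_abs]; exact Real.sqrt_lt_sqrt (by positivity) (by linarith)
    have h3 : 0 < √(c ^ 2 + ρ) - c := by linarith [le_abs_self c]
    refine ⟨√(c ^ 2 + ρ) - c, h3, ?_⟩
    simp only
    field_simp
    nlinarith
  have h := lintegral_image_eq_lintegral_abs_deriv_mul (s := Ioi (0 : ℝ)) measurableSet_Ioi
    (f := fun p : ℝ => (ρ / p - p) / 2) (f' := fun p => -((ρ / p ^ 2 + 1) / 2)) ?_ ?_ G
  · rw [himg, setLIntegral_univ] at h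
    rw [h]
    refine setLIntegral_congr_fun measurableSet_Ioi fun p hp => ?_
    rw [abs_neg, abs_of_nonneg (by positivity)]
  · intro p hp
    have hp0 : p ≠ 0 := ne_of_gt hp
    have h1 : HasDerivAt (fun p : ℝ => (ρ / p - p) / 2) _ p :=
      (((hasDerivAt_const p ρ).div (hasDerivAt_id p) hp0).sub (hasDerivAt_id p)).div_const 2
    refine (h1.congr_deriv ?_).hasDerivWithinAt
    simp only [id]
    field_simp
    ring
  · intro p hp q hq hpq
    simp only [mem_Ioi] at hp hq hpq
    have : (ρ + p * q) * (q - p) = 0 := by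
      field_simp at hpq
      linear_combination hpq
    rcases mul_eq_zero.1 this with h | h
    · nlinarith [mul_pos hp hq]
    · linarith

/-- The parametrization of `E3` by positive multiples of inverse stereographic coordinates. -/
theorem lintegral_E3_stereo {F : E3 → ℝ≥0∞} (hF : Measurable F) :
    ∫⁻ x, F x = ∫⁻ p in Ioi (0 : ℝ), ∫⁻ s, ∫⁻ q,
      ENNReal.ofReal (p ^ 2 * ((1 + s ^ 2 + q ^ 2) / 2)) *
        F !₂[p * s, p * q, p * ((s ^ 2 + q ^ 2 - 1) / 2)] := by
  have hFm : ∀ {α : Type} [MeasurableSpace α] {f g h : α → ℝ}, Measurable f → Measurable g →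
      Measurable h → Measurable fun x => F !₂[f x, g x, h x] := fun hf hg hh =>
    hF.comp (measurable_vec3.comp (hf.prodMk (hg.prodMk hh)))
  rw [lintegral_E3 hF]
  have h1 : ∀ᵐ a : ℝ, ∫⁻ b, ∫⁻ c, F !₂[a, b, c] = ∫⁻ b, ∫⁻ p in Ioi (0 : ℝ),
      ENNReal.ofReal (((a ^ 2 + b ^ 2) / p ^ 2 + 1) / 2) *
        F !₂[a, b, ((a ^ 2 + b ^ 2) / p - p) / 2] := by
    filter_upwards [Measure.ae_ne volume (0 : ℝ)] with a ha
    refine lintegral_congr fun b => ?_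
    exact lintegral_eq_lintegral_Ioi_sub (fun c => F !₂[a, b, c]) (by positivity)
  rw [lintegral_congr_ae h1]
  have h2 : ∀ a : ℝ, ∫⁻ b, ∫⁻ p in Ioi (0 : ℝ),
      ENNReal.ofReal (((a ^ 2 + b ^ 2) / p ^ 2 + 1) / 2) *
        F !₂[a, b, ((a ^ 2 + b ^ 2) / p - p) / 2] =
      ∫⁻ p in Ioi (0 : ℝ), ∫⁻ b, ENNReal.ofReal (((a ^ 2 + b ^ 2) / p ^ 2 + 1) / 2) *
        F !₂[a, b, ((a ^ 2 + b ^ 2) / p - p) / 2] := by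
    intro a
    rw [lintegral_lintegral_swap]
    apply Measurable.aemeasurable
    simp only [Function.uncurry_def]
    exact Measurable.mul (by fun_prop) (hFm (by fun_prop) (by fun_prop) (by fun_prop))
  rw [lintegral_congr h2, lintegral_lintegral_swap]
  · refine setLIntegral_congr_fun measurableSet_Ioi fun p hp => ?_
    have hp0 : p ≠ 0 := ne_of_gt hp
    have hp1 : 0 < p := hp
    rw [lintegral_eq_mul_comp_mul_left _ hp0, ← lintegral_const_mul' _ _ ENNReal.ofReal_ne_top]
    refine lintegral_congr fun s => ?_
    rw [lintegral_eq_mul_comp_mul_left _ hp0, ← lintegral_const_mul' _ _ ENNReal.ofReal_ne_top,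
      ← lintegral_const_mul' _ _ ENNReal.ofReal_ne_top]
    refine lintegral_congr fun q => ?_
    rw [← mul_assoc, ← mul_assoc, ← ENNReal.ofReal_mul (by positivity),
      ← ENNReal.ofReal_mul (by positivity), abs_of_pos hp1]
    congr 2
    · field_simp
      ring
    · congr 2
      field_simp
  · apply Measurable.aemeasurable
    simp only [Function.uncurry_def]
    refine Measurable.lintegral_prod_right' (f := fun x : (ℝ × ℝ) × ℝ =>
      ENNReal.ofReal (((x.1.1 ^ 2 + x.2 ^ 2) / x.1.2 ^ 2 + 1) / 2) *
        F !₂[x.1.1, x.2, ((x.1.1 ^ 2 + x.2 ^ 2) / x.1.2 - x.1.2) / 2]) ?_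
    exact Measurable.mul (by fun_prop) (hFm (by fun_prop) (by fun_prop) (by fun_prop))

/-- Inverse stereographic projection from the north pole `(0, 0, 1)`. -/
noncomputable def stereo (s q : ℝ) : E3 :=
  !₂[2 * s / (1 + s ^ 2 + q ^ 2), 2 * q / (1 + s ^ 2 + q ^ 2),
    (s ^ 2 + q ^ 2 - 1) / (1 + s ^ 2 + q ^ 2)]

theorem measurable_stereo {α : Type*} [MeasurableSpace α] {f g : α → ℝ} (hf : Measurable f)
    (hg : Measurable g) : Measurable fun x => stereo (f x) (g x) :=
  measurable_vec3.comp (f := fun x => (2 * f x / (1 + f x ^ 2 + g x ^ 2),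
    2 * g x / (1 + f x ^ 2 + g x ^ 2), (f x ^ 2 + g x ^ 2 - 1) / (1 + f x ^ 2 + g x ^ 2)))
    (by fun_prop)

theorem vec_eq_smul_stereo (p s q : ℝ) :
    (!₂[p * s, p * q, p * ((s ^ 2 + q ^ 2 - 1) / 2)] : E3) =
      (p * ((1 + s ^ 2 + q ^ 2) / 2)) • stereo s q := by
  have : 1 + s ^ 2 + q ^ 2 ≠ 0 := by positivity
  ext i
  fin_cases i <;> simp [stereo] <;> field_simp

theorem norm_stereo (s q : ℝ) : ‖stereo s q‖ = 1 := by
  have : 1 + s ^ 2 + q ^ 2 ≠ 0 := by positivity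
  rw [← sq_eq_sq₀ (norm_nonneg _) zero_le_one, norm_sq_eq_coords]
  simp [stereo]
  field_simp
  ring

theorem lintegral_sq_mul_indicator {r : ℝ} (hr : 0 < r) :
    ∫⁻ p in Ioi (0 : ℝ), (ENNReal.ofReal (p ^ 2 * r) * if p * r < 1 then 1 else 0) =
      ENNReal.ofReal (1 / (3 * r ^ 2)) := by
  have h1 : ∀ p : ℝ, (ENNReal.ofReal (p ^ 2 * r) * if p * r < 1 then 1 else 0) =
      (Iio (1 / r)).indicator (fun p => ENNReal.ofReal (p ^ 2 * r)) p := by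
    intro p
    simp only [indicator_apply, mem_Iio, lt_div_iff₀ hr, mul_ite, mul_one, mul_zero]
  simp_rw [h1]
  rw [setLIntegral_indicator measurableSet_Iio, inter_comm, Ioi_inter_Iio,
    setLIntegral_congr Ioo_ae_eq_Ioc,
    ← ofReal_integral_eq_lintegral_ofReal, ← intervalIntegral.integral_of_le (by positivity)]
  · congr 1
    simp
    field_simp
    norm_num
  · exact (Continuous.integrableOn_Icc (by fun_prop)).mono_set Ioc_subset_Icc_self
  · exact Eventually.of_forall fun p => by positivity

/-- The law of `x / ‖x‖` for `x` uniform in the unit ball. -/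
noncomputable def ballProj : Measure E3 :=
  (volume (Metric.ball (0 : E3) 1))⁻¹ •
    (volume.restrict (Metric.ball (0 : E3) 1)).map fun x => ‖x‖⁻¹ • x

theorem measurable_normalize : Measurable fun x : E3 => ‖x‖⁻¹ • x :=
  measurable_norm.inv.smul measurable_id

theorem ballProj_eq_sphereUniform : ballProj = sphereUniform := by
  have hpos : volume (Metric.ball (0 : E3) 1) ≠ 0 :=
    (Metric.measure_ball_pos _ _ one_pos).ne'
  have hfin : volume (Metric.ball (0 : E3) 1) ≠ ∞ := measure_ball_lt_top.ne
  have : IsProbabilityMeasure ballProj := by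
    constructor
    rw [ballProj, Measure.smul_apply, Measure.map_apply measurable_normalize MeasurableSet.univ]
    simp only [preimage_univ, Measure.restrict_apply_univ, smul_eq_mul]
    exact ENNReal.inv_mul_cancel hpos hfin
  refine eq_of_rotation_invariant (fun R => ?_) measurePreserving_sphereUniform ?_
    ae_norm_eq_one_sphereUniform
  · refine MeasurePreserving.smul_measure ?_ _
    refine ⟨R.continuous.measurable, ?_⟩
    rw [Measure.map_map R.continuous.measurable measurable_normalize]
    have h := R.measurePreserving.restrict_preimage
      (s := Metric.ball (0 : E3) 1) Metric.isOpen_ball.measurableSet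
    have h2 : R ⁻¹' Metric.ball (0 : E3) 1 = Metric.ball 0 1 := by
      ext x; simp
    rw [h2] at h
    conv_rhs => rw [← h.map_eq, Measure.map_map measurable_normalize R.continuous.measurable]
    congr 1
    ext1 x
    simp
  · refine Measure.ae_smul_measure ?_ _
    rw [ae_map_iff measurable_normalize.aemeasurable
      (measurableSet_eq_fun measurable_norm measurable_const)]
    refine ae_restrict_of_ae ?_
    filter_upwards [Measure.ae_ne volume (0 : E3)] with x hx
    simp [norm_smul, norm_ne_zero_iff.2 hx]

theorem lintegral_sphereUniform {f : E3 → ℝ≥0∞} (hf : Measurable f) :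
    ∫⁻ x, f x ∂sphereUniform = ∫⁻ s, ∫⁻ q,
      ENNReal.ofReal (1 / (Real.pi * (1 + s ^ 2 + q ^ 2) ^ 2)) * f (stereo s q) := by
  have hfm : Measurable fun z : ℝ × ℝ => f (stereo z.1 z.2) :=
    hf.comp (measurable_stereo measurable_fst measurable_snd)
  have hFm : Measurable ((Metric.ball (0 : E3) 1).indicator fun x => f (‖x‖⁻¹ • x)) :=
    (hf.comp measurable_normalize).indicator Metric.isOpen_ball.measurableSet
  rw [← ballProj_eq_sphereUniform, ballProj, lintegral_smul_measure,
    lintegral_map hf measurable_normalize,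
    ← lintegral_indicator Metric.isOpen_ball.measurableSet, lintegral_E3_stereo hFm]
  have h1 : ∀ p ∈ Ioi (0 : ℝ), ∀ s q : ℝ,
      ENNReal.ofReal (p ^ 2 * ((1 + s ^ 2 + q ^ 2) / 2)) *
        (Metric.ball (0 : E3) 1).indicator (fun x => f (‖x‖⁻¹ • x))
          !₂[p * s, p * q, p * ((s ^ 2 + q ^ 2 - 1) / 2)] =
      (ENNReal.ofReal (p ^ 2 * ((1 + s ^ 2 + q ^ 2) / 2)) *
        if p * ((1 + s ^ 2 + q ^ 2) / 2) < 1 then 1 else 0) * f (stereo s q) := by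
    classical
    intro p hp s q
    have hp : 0 < p := hp
    have hpos : 0 < p * ((1 + s ^ 2 + q ^ 2) / 2) := by positivity
    rw [vec_eq_smul_stereo]
    set t := p * ((1 + s ^ 2 + q ^ 2) / 2)
    simp only [indicator_apply, mem_ball_zero_iff, norm_smul, norm_stereo, mul_one,
      Real.norm_eq_abs, abs_of_pos hpos, smul_smul, inv_mul_cancel₀ hpos.ne', one_smul]
    split_ifs <;> simp
  have h2 : ∀ p ∈ Ioi (0 : ℝ), ∫⁻ s, ∫⁻ q,
      ENNReal.ofReal (p ^ 2 * ((1 + s ^ 2 + q ^ 2) / 2)) *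
        (Metric.ball (0 : E3) 1).indicator (fun x => f (‖x‖⁻¹ • x))
          !₂[p * s, p * q, p * ((s ^ 2 + q ^ 2 - 1) / 2)] =
      ∫⁻ z : ℝ × ℝ, (ENNReal.ofReal (p ^ 2 * ((1 + z.1 ^ 2 + z.2 ^ 2) / 2)) *
        if p * ((1 + z.1 ^ 2 + z.2 ^ 2) / 2) < 1 then 1 else 0) * f (stereo z.1 z.2) := by
    intro p hp
    rw [Measure.volume_eq_prod, lintegral_prod]
    · exact lintegral_congr fun s => lintegral_congr fun q => h1 p hp s q
    · refine (Measurable.mul (Measurable.mul (by fun_prop) ?_) hfm).aemeasurable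
      exact Measurable.ite (measurableSet_lt (by fun_prop) (by fun_prop)) measurable_const
        measurable_const
  rw [setLIntegral_congr_fun measurableSet_Ioi h2, lintegral_lintegral_swap]
  · have h3 : ∀ z : ℝ × ℝ, ∫⁻ p in Ioi (0 : ℝ),
        (ENNReal.ofReal (p ^ 2 * ((1 + z.1 ^ 2 + z.2 ^ 2) / 2)) *
        if p * ((1 + z.1 ^ 2 + z.2 ^ 2) / 2) < 1 then 1 else 0) * f (stereo z.1 z.2) =
        ENNReal.ofReal (1 / (3 * ((1 + z.1 ^ 2 + z.2 ^ 2) / 2) ^ 2)) * f (stereo z.1 z.2) := by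
      intro z
      rw [lintegral_mul_const, lintegral_sq_mul_indicator (by positivity)]
      refine Measurable.mul (by fun_prop) ?_
      exact Measurable.ite (measurableSet_lt (by fun_prop) (by fun_prop)) measurable_const
        measurable_const
    simp_rw [h3]
    rw [EuclideanSpace.volume_ball_fin_three, Measure.volume_eq_prod, lintegral_prod]
    · rw [smul_eq_mul, ← lintegral_const_mul']
      · refine lintegral_congr fun s => ?_
        rw [← lintegral_const_mul']
        · refine lintegral_congr fun q => ?_
          rw [← mul_assoc]
          congr 1
          rw [← ENNReal.ofReal_pow (by norm_num), ← ENNReal.ofReal_mul (by norm_num),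
            ← ENNReal.ofReal_inv_of_pos (by positivity), ← ENNReal.ofReal_mul (by positivity)]
          congr 1
          field_simp
          norm_num
        · simp [Real.pi_pos]
      · simp [Real.pi_pos]
    · exact (Measurable.mul (by fun_prop) hfm).aemeasurable
  · apply Measurable.aemeasurable
    simp only [Function.uncurry_def]
    refine Measurable.mul (Measurable.mul (by fun_prop) ?_) (hfm.comp measurable_snd)
    exact Measurable.ite (measurableSet_lt (by fun_prop) (by fun_prop)) measurable_const
        measurable_const

theorem tendsto_comp_arctan_atTop {P : ℝ → ℝ} (hP : Continuous P) :
    Tendsto (fun t => P (Real.arctan t)) atTop (𝓝 (P (Real.pi / 2))) :=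
  (hP.tendsto _).comp (tendsto_nhds_of_tendsto_nhdsWithin Real.tendsto_arctan_atTop)

theorem tendsto_comp_arctan_atBot {P : ℝ → ℝ} (hP : Continuous P) :
    Tendsto (fun t => P (Real.arctan t)) atBot (𝓝 (P (-(Real.pi / 2)))) :=
  (hP.tendsto _).comp (tendsto_nhds_of_tendsto_nhdsWithin Real.tendsto_arctan_atBot)

theorem integrable_div_one_add_sq_of_bound {f : ℝ → ℝ} (hf : Measurable f) {M : ℝ}
    (hM : ∀ t, |f t| ≤ M) : Integrable fun t : ℝ => f t * (1 + t ^ 2)⁻¹ := by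
  refine (integrable_inv_one_add_sq.const_mul M).mono'
    (hf.mul (by fun_prop)).aestronglyMeasurable (Eventually.of_forall fun t => ?_)
  rw [Real.norm_eq_abs, abs_mul, abs_of_nonneg (a := (1 + t ^ 2)⁻¹) (by positivity)]
  gcongr
  exact hM t

theorem cos_arctan_sq (t : ℝ) : Real.cos (Real.arctan t) ^ 2 = (1 + t ^ 2)⁻¹ := by
  rw [Real.cos_sq_arctan, one_div]

theorem sin_arctan_eq_mul_cos (t : ℝ) :
    Real.sin (Real.arctan t) = t * Real.cos (Real.arctan t) := by
  rw [Real.sin_arctan, Real.cos_arctan]; ring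

theorem abs_quadratic_div_le (a b c t : ℝ) :
    |(a * t ^ 2 + b * t + c) / (1 + t ^ 2) ^ 2| ≤ |a| + |b| + |c| := by
  rw [abs_div, abs_of_pos (a := (1 + t ^ 2) ^ 2) (by positivity), div_le_iff₀ (by positivity)]
  have h1 : |a * t ^ 2 + b * t + c| ≤ |a| * t ^ 2 + |b| * |t| + |c| := by
    refine (abs_add_le _ _).trans (add_le_add ((abs_add_le _ _).trans ?_) le_rfl)
    rw [abs_mul, abs_mul, abs_of_nonneg (sq_nonneg t)]
  have ht : t ^ 2 ≤ (1 + t ^ 2) ^ 2 := by nlinarith [sq_nonneg t]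
  have ht1 : |t| ≤ (1 + t ^ 2) ^ 2 := by
    have := abs_nonneg t
    have h2 := sq_abs t
    nlinarith [sq_nonneg (|t| - 1), sq_nonneg t]
  have ht2 : 1 ≤ (1 + t ^ 2) ^ 2 := by nlinarith [sq_nonneg t]
  have := mul_le_mul_of_nonneg_left ht (abs_nonneg a)
  have := mul_le_mul_of_nonneg_left ht1 (abs_nonneg b)
  have := mul_le_mul_of_nonneg_left ht2 (abs_nonneg c)
  linarith

theorem integrable_quadratic_div (a b c : ℝ) :
    Integrable fun t : ℝ => (a * t ^ 2 + b * t + c) / (1 + t ^ 2) ^ 3 := by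
  have h := integrable_div_one_add_sq_of_bound
    (f := fun t => (a * t ^ 2 + b * t + c) / (1 + t ^ 2) ^ 2) (by fun_prop)
    (abs_quadratic_div_le a b c)
  refine h.congr (Eventually.of_forall fun t => ?_)
  have : 1 + t ^ 2 ≠ 0 := by positivity
  simp only
  field_simp

theorem integral_quadratic_div (a b c : ℝ) :
    ∫ t : ℝ, (a * t ^ 2 + b * t + c) / (1 + t ^ 2) ^ 3 = Real.pi / 8 * (a + 3 * c) := by
  set P : ℝ → ℝ := fun θ =>
    a * (Real.sin θ * Real.cos θ / 8 - Real.sin θ * Real.cos θ ^ 3 / 4 + θ / 8)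
      - b * (Real.cos θ ^ 4 / 4)
      + c * (Real.sin θ * Real.cos θ ^ 3 / 4 + 3 * (Real.sin θ * Real.cos θ) / 8 + 3 * θ / 8)
    with hPdef
  have hPc : Continuous P := by fun_prop
  have hP : ∀ θ, HasDerivAt P (a * (Real.sin θ ^ 2 * Real.cos θ ^ 2)
      + b * (Real.sin θ * Real.cos θ ^ 3) + c * Real.cos θ ^ 4) θ := by
    intro θ
    have hs := Real.hasDerivAt_sin θ
    have hc := Real.hasDerivAt_cos θ
    have hi := hasDerivAt_id θ
    have h1 := hs.mul hc
    have h3 := hs.mul (hc.pow 3)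
    have := ((((h1.div_const 8).sub (h3.div_const 4)).add (hi.div_const 8)).const_mul a).sub
      (((hc.pow 4).div_const 4).const_mul b) |>.add
      ((((h3.div_const 4).add ((h1.const_mul 3).div_const 8)).add
        ((hi.const_mul 3).div_const 8)).const_mul c)
    refine this.congr_deriv ?_
    have hsc : Real.sin θ ^ 2 = 1 - Real.cos θ ^ 2 := by
      linarith [Real.sin_sq_add_cos_sq θ]
    simp only [Pi.pow_apply]
    push_cast
    linear_combination (-(a / 8) + a / 4 * 3 * Real.cos θ ^ 2 - a * Real.cos θ ^ 2
      - c * 3 / 4 * Real.cos θ ^ 2 - 3 * c / 8) * hsc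
  have := integral_of_hasDerivAt_of_tendsto (f := fun t => P (Real.arctan t)) (fun t => by
    refine ((hP _).comp t (Real.hasDerivAt_arctan t)).congr_deriv
      (g' := (a * t ^ 2 + b * t + c) / (1 + t ^ 2) ^ 3) ?_
    have h2 := cos_arctan_sq t
    have : 1 + t ^ 2 ≠ 0 := by positivity
    rw [sin_arctan_eq_mul_cos]
    have e : a * ((t * Real.cos (Real.arctan t)) ^ 2 * Real.cos (Real.arctan t) ^ 2) +
        b * (t * Real.cos (Real.arctan t) * Real.cos (Real.arctan t) ^ 3) +
        c * Real.cos (Real.arctan t) ^ 4 =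
        (a * t ^ 2 + b * t + c) * (Real.cos (Real.arctan t) ^ 2) ^ 2 := by ring
    rw [e, h2]
    field_simp) (integrable_quadratic_div a b c)
    (tendsto_comp_arctan_atBot hPc) (tendsto_comp_arctan_atTop hPc)
  rw [this]
  simp [hPdef]
  ring

theorem lintegral_quadratic_div {a b c : ℝ} (h : ∀ t, 0 ≤ a * t ^ 2 + b * t + c) :
    ∫⁻ t : ℝ, ENNReal.ofReal ((a * t ^ 2 + b * t + c) / (1 + t ^ 2) ^ 3) =
      ENNReal.ofReal (Real.pi / 8 * (a + 3 * c)) := by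
  rw [← integral_quadratic_div a b c, ofReal_integral_eq_lintegral_ofReal
    (integrable_quadratic_div a b c)]
  exact Eventually.of_forall fun t => div_nonneg (h t) (by positivity)

theorem lintegral_lintegral_sq_sub_div :
    ∫⁻ s : ℝ, ∫⁻ t : ℝ, ENNReal.ofReal ((s - t) ^ 2 / ((1 + s ^ 2) ^ 3 * (1 + t ^ 2) ^ 3)) =
      ENNReal.ofReal (3 * Real.pi ^ 2 / 32) := by
  have h1 : ∀ s : ℝ,
      ∫⁻ t : ℝ, ENNReal.ofReal ((s - t) ^ 2 / ((1 + s ^ 2) ^ 3 * (1 + t ^ 2) ^ 3)) =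
      ENNReal.ofReal ((3 * Real.pi / 8 * s ^ 2 + 0 * s + Real.pi / 8) / (1 + s ^ 2) ^ 3) := by
    intro s
    have h2 : ∀ t : ℝ, ENNReal.ofReal ((s - t) ^ 2 / ((1 + s ^ 2) ^ 3 * (1 + t ^ 2) ^ 3)) =
        ENNReal.ofReal (1 / (1 + s ^ 2) ^ 3) *
          ENNReal.ofReal ((1 * t ^ 2 + (-2 * s) * t + s ^ 2) / (1 + t ^ 2) ^ 3) := by
      intro t
      rw [← ENNReal.ofReal_mul (by positivity)]
      congr 1
      field_simp
      ring
    simp_rw [h2]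
    rw [lintegral_const_mul' _ _ ENNReal.ofReal_ne_top, lintegral_quadratic_div,
      ← ENNReal.ofReal_mul (by positivity)]
    · congr 1
      field_simp
      ring
    · intro t
      nlinarith [sq_nonneg (t - s)]
  simp_rw [h1]
  rw [lintegral_quadratic_div]
  · congr 1
    ring
  · intro t
    rw [zero_mul, add_zero]
    positivity

theorem lintegral_lintegral_sq_sub_div_affine {α β : ℝ} (c : ℝ) (hα : 0 < α) (hβ : 0 < β) :
    ∫⁻ s : ℝ, ∫⁻ t : ℝ, ENNReal.ofReal ((s - t) ^ 2 /
      ((α * (s + c) ^ 2 + β) ^ 3 * (α * (t + c) ^ 2 + β) ^ 3)) =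
      ENNReal.ofReal (3 * Real.pi ^ 2 / 32 / (α ^ 2 * β ^ 4)) := by
  set l := √(β / α)
  have hl : 0 < l := by positivity
  have hl2 : l ^ 2 = β / α := Real.sq_sqrt (by positivity)
  have shift : ∀ G : ℝ → ℝ≥0∞, ∫⁻ s, G s = ENNReal.ofReal l * ∫⁻ s, G (l * s - c) := by
    intro G
    rw [← lintegral_sub_right_eq_self G c, lintegral_eq_mul_comp_mul_left _ hl.ne', abs_of_pos hl]
  have hq : ∀ s, α * (l * s - c + c) ^ 2 + β = β * (1 + s ^ 2) := by
    intro s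
    have : α * (l * s - c + c) ^ 2 = α * l ^ 2 * s ^ 2 := by ring
    rw [this, hl2]
    field_simp
    ring
  rw [shift]
  simp_rw [shift (fun t => ENNReal.ofReal ((_ - t) ^ 2 / _)), hq]
  rw [lintegral_const_mul' _ _ ENNReal.ofReal_ne_top]
  have h1 : ∀ s t : ℝ, ENNReal.ofReal ((l * s - c - (l * t - c)) ^ 2 /
      ((β * (1 + s ^ 2)) ^ 3 * (β * (1 + t ^ 2)) ^ 3)) = ENNReal.ofReal (l ^ 2 / β ^ 6) *
      ENNReal.ofReal ((s - t) ^ 2 / ((1 + s ^ 2) ^ 3 * (1 + t ^ 2) ^ 3)) := by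
    intro s t
    rw [← ENNReal.ofReal_mul (by positivity)]
    congr 1
    field_simp
    ring
  simp_rw [h1, lintegral_const_mul' _ _ ENNReal.ofReal_ne_top, lintegral_lintegral_sq_sub_div]
  rw [← ENNReal.ofReal_mul (by positivity), ← ENNReal.ofReal_mul (by positivity),
    ← ENNReal.ofReal_mul (by positivity)]
  congr 1
  have : l * (l * (l ^ 2 / β ^ 6 * (3 * Real.pi ^ 2 / 32))) =
      l ^ 2 * l ^ 2 / β ^ 6 * (3 * Real.pi ^ 2 / 32) := by ring
  rw [this, hl2]
  field_simp

theorem integral_radial (k : ℕ) :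
    ∫ v in Ioi (0 : ℝ), v * (v / √(1 + v ^ 2)) ^ k / (1 + v ^ 2) ^ 4 =
      8 / (((k : ℝ) + 2) * (k + 4) * (k + 6)) := by
  set P : ℝ → ℝ := fun θ => Real.sin θ ^ (k + 2) / (k + 2) - 2 * Real.sin θ ^ (k + 4) / (k + 4)
    + Real.sin θ ^ (k + 6) / (k + 6) with hPdef
  have hPc : Continuous P := by fun_prop
  have hP : ∀ θ, HasDerivAt P (Real.sin θ ^ (k + 1) * Real.cos θ ^ 5) θ := by
    intro θ
    have hs := Real.hasDerivAt_sin θ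
    have := (((hs.pow (k + 2)).div_const ((k : ℝ) + 2)).sub
      (((hs.pow (k + 4)).const_mul 2).div_const ((k : ℝ) + 4))).add
      ((hs.pow (k + 6)).div_const ((k : ℝ) + 6))
    refine this.congr_deriv ?_
    have hsc : Real.cos θ ^ 2 = 1 - Real.sin θ ^ 2 := by
      linarith [Real.sin_sq_add_cos_sq θ]
    have h5 : Real.cos θ ^ 5 = (1 - Real.sin θ ^ 2) ^ 2 * Real.cos θ := by
      rw [← hsc]; ring
    have e1 : k + 2 - 1 = k + 1 := rfl
    have e2 : k + 4 - 1 = k + 3 := rfl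
    have e3 : k + 6 - 1 = k + 5 := rfl
    rw [h5, e1, e2, e3]
    have : (k : ℝ) + 2 ≠ 0 := by positivity
    have : (k : ℝ) + 4 ≠ 0 := by positivity
    have : (k : ℝ) + 6 ≠ 0 := by positivity
    push_cast
    field_simp
    ring
  have := integral_Ioi_of_hasDerivAt_of_nonneg' (g := fun t => P (Real.arctan t))
    (g' := fun v => v * (v / √(1 + v ^ 2)) ^ k / (1 + v ^ 2) ^ 4) (a := 0) (fun v _ => by
    refine ((hP _).comp v (Real.hasDerivAt_arctan v)).congr_deriv ?_
    have h2 := cos_arctan_sq v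
    have e : Real.sin (Real.arctan v) ^ (k + 1) * Real.cos (Real.arctan v) ^ 5 =
        v * Real.sin (Real.arctan v) ^ k * (Real.cos (Real.arctan v) ^ 2) ^ 3 := by
      rw [pow_succ]
      nth_rewrite 2 [sin_arctan_eq_mul_cos]
      ring
    rw [e, h2, Real.sin_arctan]
    have : 1 + v ^ 2 ≠ 0 := by positivity
    field_simp) (fun v hv => by
    have hv : 0 < v := hv
    positivity)
    (tendsto_comp_arctan_atTop hPc)
  rw [this]
  simp [hPdef]
  have : (k : ℝ) + 2 ≠ 0 := by positivity
  have : (k : ℝ) + 4 ≠ 0 := by positivity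
  have : (k : ℝ) + 6 ≠ 0 := by positivity
  field_simp
  ring

theorem lintegral_radial (k : ℕ) :
    ∫⁻ v : ℝ, ENNReal.ofReal (|v| * (|v| / √(1 + v ^ 2)) ^ k / (1 + v ^ 2) ^ 4) =
      ENNReal.ofReal (16 / (((k : ℝ) + 2) * (k + 4) * (k + 6))) := by
  have hbd : ∀ v : ℝ, |v| / √(1 + v ^ 2) ≤ 1 := by
    intro v
    rw [div_le_one (by positivity), ← Real.sqrt_sq_eq_abs]
    exact Real.sqrt_le_sqrt (by linarith)
  have hint : Integrable fun v : ℝ => |v| * (|v| / √(1 + v ^ 2)) ^ k / (1 + v ^ 2) ^ 4 := by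
    have h := integrable_div_one_add_sq_of_bound
      (f := fun v => |v| * (|v| / √(1 + v ^ 2)) ^ k / (1 + v ^ 2) ^ 3) (M := 1) (by fun_prop) ?_
    · refine h.congr (Eventually.of_forall fun t => ?_)
      have : 1 + t ^ 2 ≠ 0 := by positivity
      simp only
      field_simp
    · intro v
      rw [abs_of_nonneg (by positivity), div_le_one (by positivity)]
      have h1 : (|v| / √(1 + v ^ 2)) ^ k ≤ 1 := pow_le_one₀ (by positivity) (hbd v)
      have h2 : |v| ≤ 1 + v ^ 2 := by nlinarith [sq_nonneg (|v| - 1), sq_abs v]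
      have h3 : 1 + v ^ 2 ≤ (1 + v ^ 2) ^ 3 :=
        le_self_pow₀ (by nlinarith [sq_nonneg v]) (by norm_num)
      calc |v| * (|v| / √(1 + v ^ 2)) ^ k ≤ |v| * 1 := by gcongr
        _ ≤ _ := by linarith
  rw [← ofReal_integral_eq_lintegral_ofReal hint
    (Eventually.of_forall fun v => by positivity)]
  have h := integral_comp_abs (f := fun v : ℝ => v * (v / √(1 + v ^ 2)) ^ k / (1 + v ^ 2) ^ 4)
  simp only [sq_abs] at h
  rw [h, integral_radial]
  congr 1
  ring

theorem lintegral_inv_one_add_sq :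
    ∫⁻ m : ℝ, ENNReal.ofReal ((1 + m ^ 2)⁻¹) = ENNReal.ofReal Real.pi := by
  rw [← integral_univ_inv_one_add_sq, ofReal_integral_eq_lintegral_ofReal
    integrable_inv_one_add_sq (Eventually.of_forall fun m => by positivity)]

/-- Archimedes' hat-box theorem. -/
theorem sphereUniform_abs_coord_le {h : ℝ} (h0 : 0 ≤ h) (h1 : h ≤ 1) :
    sphereUniform {x : E3 | |x 2| ≤ h} = ENNReal.ofReal h := by
  have hm : MeasurableSet {x : E3 | |x 2| ≤ h} :=
    measurableSet_le (by fun_prop) measurable_const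
  rcases h1.eq_or_lt with rfl | h1
  · rw [ENNReal.ofReal_one, prob_compl_eq_zero_iff hm |>.1]
    change ∀ᵐ x ∂sphereUniform, |x 2| ≤ 1
    filter_upwards [ae_norm_eq_one_sphereUniform] with x hx
    rw [← hx]
    simpa using PiLp.norm_apply_le x 2
  rw [← lintegral_indicator_one hm, lintegral_sphereUniform (measurable_one.indicator hm)]
  have hmeas : Measurable fun z : ℝ × ℝ => ENNReal.ofReal
      (1 / (Real.pi * (1 + z.1 ^ 2 + z.2 ^ 2) ^ 2)) *
        {x : E3 | |x 2| ≤ h}.indicator 1 (stereo z.1 z.2) :=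
    Measurable.mul (by fun_prop) ((measurable_one.indicator hm).comp
      (measurable_stereo measurable_fst measurable_snd))
  rw [← lintegral_prod (fun z : ℝ × ℝ => ENNReal.ofReal
      (1 / (Real.pi * (1 + z.1 ^ 2 + z.2 ^ 2) ^ 2)) *
        {x : E3 | |x 2| ≤ h}.indicator 1 (stereo z.1 z.2)) hmeas.aemeasurable,
    ← Measure.volume_eq_prod, ← lintegral_comp_polarCoord_symm, polarCoord_target,
    Measure.volume_eq_prod, ← Measure.prod_restrict, lintegral_prod]
  swap
  · exact (measurable_fst.ennreal_ofReal.smul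
      (hmeas.comp continuous_polarCoord_symm.measurable)).aemeasurable
  set a := √((1 - h) / (1 + h))
  set b := √((1 + h) / (1 - h))
  have hh : 0 < 1 - h := by linarith
  have ha2 : a ^ 2 = (1 - h) / (1 + h) := Real.sq_sqrt (by positivity)
  have hb2 : b ^ 2 = (1 + h) / (1 - h) := Real.sq_sqrt (by positivity)
  have hapos : 0 < a := by positivity
  have hbpos : 0 < b := by positivity
  have hab : a ≤ b := by
    apply Real.sqrt_le_sqrt
    rw [div_le_div_iff₀ (by positivity) hh]
    nlinarith
  have key : ∀ u ∈ Ioi (0 : ℝ), ∀ θ : ℝ, ENNReal.ofReal (u, θ).1 •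
      (ENNReal.ofReal (1 / (Real.pi * (1 + (polarCoord.symm (u, θ)).1 ^ 2 +
        (polarCoord.symm (u, θ)).2 ^ 2) ^ 2)) * {x : E3 | |x 2| ≤ h}.indicator 1
          (stereo (polarCoord.symm (u, θ)).1 (polarCoord.symm (u, θ)).2)) =
      (Icc a b).indicator (fun u => ENNReal.ofReal (u / (Real.pi * (1 + u ^ 2) ^ 2))) u := by
    intro u hu θ
    have hu : 0 < u := hu
    have e : (u * Real.cos θ) ^ 2 + (u * Real.sin θ) ^ 2 = u ^ 2 := by
      rw [mul_pow, mul_pow, ← mul_add, Real.cos_sq_add_sin_sq, mul_one]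
    have hiff : stereo (u * Real.cos θ) (u * Real.sin θ) ∈ {x : E3 | |x 2| ≤ h} ↔
        u ∈ Icc a b := by
      have : stereo (u * Real.cos θ) (u * Real.sin θ) 2 = (u ^ 2 - 1) / (1 + u ^ 2) := by
        simp [stereo, add_assoc, e]
      rw [mem_ofPred_eq, this, abs_le, le_div_iff₀ (by positivity), div_le_iff₀ (by positivity),
        mem_Icc, ← sq_le_sq₀ hapos.le hu.le, ← sq_le_sq₀ hu.le hbpos.le, ha2, hb2,
        div_le_iff₀ (by positivity), le_div_iff₀ hh]
      constructor <;> rintro ⟨h1, h2⟩ <;> constructor <;> nlinarith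
    by_cases hmem : u ∈ Icc a b
    · rw [indicator_of_mem hmem, polarCoord_symm_apply, indicator_of_mem (hiff.2 hmem)]
      simp only [smul_eq_mul, Pi.one_apply, mul_one, add_assoc, e]
      rw [← ENNReal.ofReal_mul hu.le]
      congr 1
      ring
    · rw [indicator_of_notMem hmem, polarCoord_symm_apply, indicator_of_notMem (hiff.not.2 hmem)]
      simp
  rw [setLIntegral_congr_fun measurableSet_Ioi fun u hu => lintegral_congr fun θ => key u hu θ]
  simp only [lintegral_const, Measure.restrict_apply_univ, Real.volume_Ioo]
  have hsub : Icc a b ⊆ Ioi 0 := fun u hu => hapos.trans_le hu.1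
  rw [lintegral_mul_const', setLIntegral_indicator measurableSet_Icc,
    inter_eq_left.2 hsub, setLIntegral_congr Ioc_ae_eq_Icc.symm,
    ← ofReal_integral_eq_lintegral_ofReal, ← intervalIntegral.integral_of_le hab]
  · have hF : ∀ u : ℝ, HasDerivAt (fun u => -(1 / (2 * Real.pi * (1 + u ^ 2))))
        (u / (Real.pi * (1 + u ^ 2) ^ 2)) u := by
      intro u
      have h1 : 1 + u ^ 2 ≠ 0 := by positivity
      have h2 := ((((hasDerivAt_id u).pow 2).const_add 1).const_mul (2 * Real.pi)).fun_inv
        (by simp; positivity) |>.fun_neg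
      simp only [one_div]
      refine h2.congr_deriv ?_
      simp
      field_simp
    rw [intervalIntegral.integral_eq_sub_of_hasDerivAt (fun u _ => hF u)]
    · rw [← ENNReal.ofReal_mul' (by linarith [Real.pi_pos])]
      congr 1
      rw [ha2, hb2]
      field_simp
      ring
    · apply Continuous.intervalIntegrable
      refine Continuous.div (by fun_prop) (by fun_prop) fun u => by positivity
  · refine (Continuous.integrableOn_Icc ?_).mono_set Ioc_subset_Icc_self
    exact Continuous.div (by fun_prop) (by fun_prop) fun u => by positivity
  · filter_upwards [ae_restrict_mem measurableSet_Ioc] with u hu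
    have : 0 < u := hapos.trans hu.1
    positivity
  · simp

theorem sphereUniform_abs_inner_le {N : E3} (hN : N ≠ 0) {c : ℝ} (h0 : 0 ≤ c) (h1 : c ≤ ‖N‖) :
    sphereUniform {x : E3 | |inner ℝ N x| ≤ c} = ENNReal.ofReal (c / ‖N‖) := by
  have hN0 : 0 < ‖N‖ := norm_pos_iff.2 hN
  obtain ⟨R, hR⟩ := exists_linearIsometryEquiv_apply_eq (v := N)
    (w := EuclideanSpace.single 2 ‖N‖) (by simp)
  have hm : MeasurableSet {x : E3 | |x 2| ≤ c / ‖N‖} :=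
    measurableSet_le (by fun_prop) measurable_const
  rw [← sphereUniform_abs_coord_le (h := c / ‖N‖) (by positivity) ((div_le_one hN0).2 h1),
    ← (measurePreserving_sphereUniform R).measure_preimage hm.nullMeasurableSet]
  congr 1
  ext x
  rw [mem_ofPred_eq, mem_preimage, mem_ofPred_eq, ← R.inner_map_map N x, hR,
    le_div_iff₀ hN0, EuclideanSpace.inner_single_left]
  simp [abs_mul, mul_comm]

theorem sphereUniform_abs_inner_eq {N : E3} (hN : N ≠ 0) (c : ℝ) :
    sphereUniform {x : E3 | |inner ℝ N x| = c} = 0 := by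
  have hN0 : 0 < ‖N‖ := norm_pos_iff.2 hN
  rcases lt_or_ge c 0 with hc | hc
  · have : {x : E3 | |inner ℝ N x| = c} = ∅ := by
      ext x; simp; intro h; linarith [abs_nonneg (inner ℝ N x)]
    simp [this]
  rcases lt_or_ge ‖N‖ c with h | h
  · rw [measure_eq_zero_iff_ae_notMem]
    filter_upwards [ae_norm_eq_one_sphereUniform] with x hx h2
    have := abs_real_inner_le_norm N x
    rw [hx, mul_one] at this
    linarith
  rcases hc.eq_or_lt with rfl | hc0
  · have h3 := sphereUniform_abs_inner_le hN le_rfl h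
    rw [zero_div, ENNReal.ofReal_zero] at h3
    exact measure_mono_null (fun x hx => le_of_eq hx) h3
  have hle : ∀ c' ∈ Ioo 0 c, sphereUniform {x : E3 | |inner ℝ N x| = c} ≤
      ENNReal.ofReal ((c - c') / ‖N‖) := by
    rintro c' ⟨h0, h1⟩
    have hsub : {x : E3 | |inner ℝ N x| = c} ⊆
        {x : E3 | |inner ℝ N x| ≤ c} \ {x : E3 | |inner ℝ N x| ≤ c'} := by
      intro x hx
      rw [mem_ofPred_eq] at hx
      simp [hx, h1]
    refine (measure_mono hsub).trans_eq ?_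
    have hsub' : {x : E3 | |inner ℝ N x| ≤ c'} ⊆ {x : E3 | |inner ℝ N x| ≤ c} :=
      fun x hx => le_trans hx h1.le
    have hm : MeasurableSet {x : E3 | |inner ℝ N x| ≤ c'} :=
      measurableSet_le (by fun_prop) measurable_const
    rw [measure_sdiff hsub' hm.nullMeasurableSet (measure_ne_top _ _),
      sphereUniform_abs_inner_le hN hc h, sphereUniform_abs_inner_le hN h0.le (h1.le.trans h),
      ← ENNReal.ofReal_sub _ (by positivity), sub_div]
  have ht : Tendsto (fun c' => ENNReal.ofReal ((c - c') / ‖N‖)) (𝓝[<] c)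
      (𝓝 (ENNReal.ofReal ((c - c) / ‖N‖))) := by
    apply tendsto_nhdsWithin_of_tendsto_nhds
    apply (Continuous.tendsto _ c)
    exact ENNReal.continuous_ofReal.comp (by fun_prop)
  rw [sub_self, zero_div, ENNReal.ofReal_zero] at ht
  refine le_antisymm (ge_of_tendsto ht ?_) zero_le
  filter_upwards [Ioo_mem_nhdsLT hc0] with c' hc' using hle c' hc'

/-- The determinant of three vectors of `ℝ³`. -/
def det3 (a b c : E3) : ℝ :=
  a 0 * (b 1 * c 2 - b 2 * c 1) - a 1 * (b 0 * c 2 - b 2 * c 0) + a 2 * (b 0 * c 1 - b 1 * c 0)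

/-- A normal vector of the plane through three points of `ℝ³`. -/
noncomputable def planeNormal (a b c : E3) : E3 :=
  !₂[(b 1 * c 2 - b 2 * c 1) + (c 1 * a 2 - c 2 * a 1) + (a 1 * b 2 - a 2 * b 1),
    (b 2 * c 0 - b 0 * c 2) + (c 2 * a 0 - c 0 * a 2) + (a 2 * b 0 - a 0 * b 2),
    (b 0 * c 1 - b 1 * c 0) + (c 0 * a 1 - c 1 * a 0) + (a 0 * b 1 - a 1 * b 0)]

theorem inner_eq_coords (x y : E3) : inner ℝ x y = x 0 * y 0 + x 1 * y 1 + x 2 * y 2 := by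
  simp [PiLp.inner_apply, Fin.sum_univ_three, mul_comm]

theorem inner_planeNormal (a b c x : E3) :
    inner ℝ (planeNormal a b c) x = det3 x b c + det3 a x c + det3 a b x := by
  rw [inner_eq_coords]
  simp [planeNormal, det3]
  ring

theorem det3_self_left (a b : E3) : det3 a a b = 0 := by simp [det3]; ring
theorem det3_self_right (a b : E3) : det3 a b b = 0 := by simp [det3]; ring
theorem det3_self_mid (a b : E3) : det3 a b a = 0 := by simp [det3]; ring

theorem det3_smul_eq (a b c y : E3) :
    det3 a b c • y = det3 y b c • a + det3 a y c • b + det3 a b y • c := by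
  ext i
  fin_cases i <;> simp [det3] <;> ring

theorem det3_sq_eq_gram (a b c : E3) :
    det3 a b c ^ 2 = ‖a‖ ^ 2 * (‖b‖ ^ 2 * ‖c‖ ^ 2 - inner ℝ b c ^ 2)
      - inner ℝ a b * (inner ℝ a b * ‖c‖ ^ 2 - inner ℝ b c * inner ℝ a c)
      + inner ℝ a c * (inner ℝ a b * inner ℝ b c - ‖b‖ ^ 2 * inner ℝ a c) := by
  simp only [inner_eq_coords, norm_sq_eq_coords, det3]
  ring

theorem norm_planeNormal_sq (a b c : E3) :
    ‖planeNormal a b c‖ ^ 2 = ‖b - a‖ ^ 2 * ‖c - a‖ ^ 2 - inner ℝ (b - a) (c - a) ^ 2 := by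
  simp only [inner_eq_coords, norm_sq_eq_coords]
  simp [planeNormal]
  ring

theorem abs_det3_map (R : E3 ≃ₗᵢ[ℝ] E3) (a b c : E3) :
    |det3 (R a) (R b) (R c)| = |det3 a b c| := by
  rw [← sq_eq_sq₀ (abs_nonneg _) (abs_nonneg _), sq_abs, sq_abs, det3_sq_eq_gram, det3_sq_eq_gram]
  simp only [LinearIsometryEquiv.norm_map, LinearIsometryEquiv.inner_map_map]

theorem norm_planeNormal_map (R : E3 ≃ₗᵢ[ℝ] E3) (a b c : E3) :
    ‖planeNormal (R a) (R b) (R c)‖ = ‖planeNormal a b c‖ := by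
  rw [← sq_eq_sq₀ (norm_nonneg _) (norm_nonneg _), norm_planeNormal_sq, norm_planeNormal_sq]
  simp only [← map_sub, LinearIsometryEquiv.norm_map, LinearIsometryEquiv.inner_map_map]

theorem continuous_det3 {α : Type*} [TopologicalSpace α] {f g h : α → E3} (hf : Continuous f)
    (hg : Continuous g) (hh : Continuous h) : Continuous fun x => det3 (f x) (g x) (h x) := by
  unfold det3
  fun_prop

theorem continuous_planeNormal {α : Type*} [TopologicalSpace α] {f g h : α → E3}
    (hf : Continuous f) (hg : Continuous g) (hh : Continuous h) :
    Continuous fun x => planeNormal (f x) (g x) (h x) := by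
  refine (PiLp.continuous_toLp 2 _).comp (continuous_pi fun i => ?_)
  fin_cases i <;> simp <;> fun_prop

theorem measurable_det3 {α : Type*} [MeasurableSpace α] {f g h : α → E3} (hf : Measurable f)
    (hg : Measurable g) (hh : Measurable h) : Measurable fun x => det3 (f x) (g x) (h x) :=
  (continuous_det3 continuous_fst (continuous_fst.comp continuous_snd)
    (continuous_snd.comp continuous_snd)).measurable.comp (hf.prodMk (hg.prodMk hh))

theorem measurable_planeNormal {α : Type*} [MeasurableSpace α] {f g h : α → E3}
    (hf : Measurable f) (hg : Measurable g) (hh : Measurable h) :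
    Measurable fun x => planeNormal (f x) (g x) (h x) :=
  (continuous_planeNormal continuous_fst (continuous_fst.comp continuous_snd)
    (continuous_snd.comp continuous_snd)).measurable.comp (hf.prodMk (hg.prodMk hh))

theorem abs_det3_le_norm_planeNormal {a : E3} (ha : ‖a‖ = 1) (b c : E3) :
    |det3 a b c| ≤ ‖planeNormal a b c‖ := by
  have h := abs_real_inner_le_norm (planeNormal a b c) a
  rwa [inner_planeNormal, det3_self_mid, det3_self_left, add_zero, add_zero, ha, mul_one] at h

theorem planeNormal_ne_zero {a b c : E3} (h : det3 a b c ≠ 0) : planeNormal a b c ≠ 0 := by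
  intro h0
  have := inner_planeNormal a b c a
  rw [h0, inner_zero_left, det3_self_mid, det3_self_left, add_zero, add_zero] at this
  exact h this.symm

/-- The integrand whose triple integral gives the expected volume. -/
noncomputable def hullWeight (k : ℕ) (a b c : E3) : ℝ≥0∞ :=
  ENNReal.ofReal (|det3 a b c| * (|det3 a b c| / ‖planeNormal a b c‖) ^ k)

theorem measurable_hullWeight {α : Type*} [MeasurableSpace α] (k : ℕ) {f g h : α → E3}
    (hf : Measurable f) (hg : Measurable g) (hh : Measurable h) :
    Measurable fun x => hullWeight k (f x) (g x) (h x) := by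
  have h1 := measurable_det3 hf hg hh
  have h2 := measurable_planeNormal hf hg hh
  have h3 : Measurable fun x => |det3 (f x) (g x) (h x)| := by
    simpa only [Real.norm_eq_abs] using h1.norm
  exact (h3.mul ((h3.div h2.norm).pow_const k)).ennreal_ofReal

theorem hullWeight_map (R : E3 ≃ₗᵢ[ℝ] E3) (k : ℕ) (a b c : E3) :
    hullWeight k (R a) (R b) (R c) = hullWeight k a b c := by
  simp only [hullWeight, abs_det3_map, norm_planeNormal_map]

theorem lintegral_lintegral_comm₄ {f : ℝ → ℝ → ℝ → ℝ → ℝ≥0∞}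
    (hf : Measurable fun z : (ℝ × ℝ) × (ℝ × ℝ) => f z.1.1 z.1.2 z.2.1 z.2.2) :
    ∫⁻ s, ∫⁻ t, ∫⁻ m, ∫⁻ b, f s t m b = ∫⁻ m, ∫⁻ b, ∫⁻ s, ∫⁻ t, f s t m b := by
  have h1 : ∀ s t, ∫⁻ m, ∫⁻ b, f s t m b = ∫⁻ w : ℝ × ℝ, f s t w.1 w.2 := fun s t =>
    (lintegral_prod (fun w : ℝ × ℝ => f s t w.1 w.2)
      (hf.comp (measurable_prodMk_left (x := (s, t)))).aemeasurable).symm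
  have h2 : ∀ m b, ∫⁻ s, ∫⁻ t, f s t m b = ∫⁻ w : ℝ × ℝ, f w.1 w.2 m b := fun m b =>
    (lintegral_prod (fun w : ℝ × ℝ => f w.1 w.2 m b)
      (hf.comp (measurable_prodMk_right (y := (m, b)))).aemeasurable).symm
  simp only [h1, h2]
  rw [← lintegral_prod (fun z : ℝ × ℝ => ∫⁻ w : ℝ × ℝ, f z.1 z.2 w.1 w.2)
      hf.lintegral_prod_right'.aemeasurable,
    ← lintegral_prod (fun w : ℝ × ℝ => ∫⁻ z : ℝ × ℝ, f z.1 z.2 w.1 w.2)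
      hf.lintegral_prod_left'.aemeasurable]
  exact lintegral_lintegral_swap hf.aemeasurable

/-- Parametrization of pairs of points with distinct abscissae by the line through them. -/
theorem lintegral_lintegral_line {f : ℝ → ℝ → ℝ≥0∞} (hf : Measurable fun z : ℝ × ℝ => f z.1 z.2)
    {s t : ℝ} (hst : t ≠ s) :
    ∫⁻ q, ∫⁻ r, f q r =
      ∫⁻ m, ∫⁻ b, ENNReal.ofReal |t - s| * f (b + m * s) (b + m * t) := by
  have h1 : ∀ q, ∫⁻ r, f q r = ENNReal.ofReal |t - s| * ∫⁻ m, f q (q + (t - s) * m) := by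
    intro q
    rw [← lintegral_add_left_eq_self (fun r => f q r) q,
      lintegral_eq_mul_comp_mul_left _ (sub_ne_zero.2 hst)]
  simp only [h1]
  rw [lintegral_const_mul']
  swap
  · simp
  have hm : Measurable (Function.uncurry fun q m => f q (q + (t - s) * m)) :=
    hf.comp (f := fun z : ℝ × ℝ => (z.1, z.1 + (t - s) * z.2)) (by fun_prop)
  rw [lintegral_lintegral_swap hm.aemeasurable, ← lintegral_const_mul' _ _ (by simp)]
  refine lintegral_congr fun m => ?_
  rw [← lintegral_add_right_eq_self _ (m * s), ← lintegral_const_mul' _ _ (by simp)]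
  refine lintegral_congr fun b => ?_
  congr 2
  ring

theorem det3_north_stereo (s t m b : ℝ) :
    det3 (EuclideanSpace.single 2 1) (stereo s (b + m * s)) (stereo t (b + m * t)) =
      4 * b * (s - t) / ((1 + s ^ 2 + (b + m * s) ^ 2) * (1 + t ^ 2 + (b + m * t) ^ 2)) := by
  have h1 : 1 + s ^ 2 + (b + m * s) ^ 2 ≠ 0 := by positivity
  have h2 : 1 + t ^ 2 + (b + m * t) ^ 2 ≠ 0 := by positivity
  simp [det3, stereo]
  field_simp
  ring

theorem norm_planeNormal_north_stereo (s t m b : ℝ) :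
    ‖planeNormal (EuclideanSpace.single 2 1) (stereo s (b + m * s)) (stereo t (b + m * t))‖ =
      4 * |s - t| / ((1 + s ^ 2 + (b + m * s) ^ 2) * (1 + t ^ 2 + (b + m * t) ^ 2)) *
        √(1 + m ^ 2 + b ^ 2) := by
  have h1 : 0 < 1 + s ^ 2 + (b + m * s) ^ 2 := by positivity
  have h2 : 0 < 1 + t ^ 2 + (b + m * t) ^ 2 := by positivity
  rw [← sq_eq_sq₀ (norm_nonneg _) (by positivity), norm_sq_eq_coords, mul_pow, div_pow,
    Real.sq_sqrt (by positivity), mul_pow, sq_abs]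
  simp [planeNormal, stereo]
  field_simp
  ring

/-- The integrand after passing to stereographic coordinates and parametrizing by lines. -/
theorem hullWeight_north_stereo (k : ℕ) {s t : ℝ} (hst : t ≠ s) (m b : ℝ) :
    ENNReal.ofReal |t - s| *
      (ENNReal.ofReal (1 / (Real.pi * (1 + s ^ 2 + (b + m * s) ^ 2) ^ 2)) *
        (ENNReal.ofReal (1 / (Real.pi * (1 + t ^ 2 + (b + m * t) ^ 2) ^ 2)) *
          hullWeight k (EuclideanSpace.single 2 1) (stereo s (b + m * s))
            (stereo t (b + m * t)))) =
      ENNReal.ofReal (4 / Real.pi ^ 2 * (|b| * (|b| / √(1 + m ^ 2 + b ^ 2)) ^ k)) *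
        ENNReal.ofReal ((s - t) ^ 2 / (((1 + m ^ 2) * (s + m * b / (1 + m ^ 2)) ^ 2 +
          (1 + m ^ 2 + b ^ 2) / (1 + m ^ 2)) ^ 3 * ((1 + m ^ 2) * (t + m * b / (1 + m ^ 2)) ^ 2 +
          (1 + m ^ 2 + b ^ 2) / (1 + m ^ 2)) ^ 3)) := by
  have hA : ∀ s : ℝ, (1 + m ^ 2) * (s + m * b / (1 + m ^ 2)) ^ 2 +
      (1 + m ^ 2 + b ^ 2) / (1 + m ^ 2) = 1 + s ^ 2 + (b + m * s) ^ 2 := by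
    intro s
    have : 1 + m ^ 2 ≠ 0 := by positivity
    field_simp
    ring
  have h1 : 0 < 1 + s ^ 2 + (b + m * s) ^ 2 := by positivity
  have h2 : 0 < 1 + t ^ 2 + (b + m * t) ^ 2 := by positivity
  have h3 : 0 < |s - t| := abs_pos.2 (sub_ne_zero.2 hst.symm)
  have h4 : 0 < √(1 + m ^ 2 + b ^ 2) := by positivity
  have hq : |det3 (EuclideanSpace.single 2 1) (stereo s (b + m * s)) (stereo t (b + m * t))| =
      4 * |b| * |s - t| /
        ((1 + s ^ 2 + (b + m * s) ^ 2) * (1 + t ^ 2 + (b + m * t) ^ 2)) := by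
    rw [det3_north_stereo, abs_div, abs_mul, abs_mul, abs_of_pos (mul_pos h1 h2)]
    simp
  rw [hA, hA, hullWeight, hq, norm_planeNormal_north_stereo, ← ENNReal.ofReal_mul (by positivity),
    ← ENNReal.ofReal_mul (by positivity), ← ENNReal.ofReal_mul (by positivity),
    ← ENNReal.ofReal_mul (by positivity), abs_sub_comm t s, ← sq_abs (s - t)]
  have h5 : 4 * |b| * |s - t| /
        ((1 + s ^ 2 + (b + m * s) ^ 2) * (1 + t ^ 2 + (b + m * t) ^ 2)) /
      (4 * |s - t| / ((1 + s ^ 2 + (b + m * s) ^ 2) * (1 + t ^ 2 + (b + m * t) ^ 2)) *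
        √(1 + m ^ 2 + b ^ 2)) = |b| / √(1 + m ^ 2 + b ^ 2) := by
    field_simp
  rw [h5]
  generalize (|b| / √(1 + m ^ 2 + b ^ 2)) ^ k = x
  congr 1
  have := Real.pi_pos
  field_simp

theorem lintegral_hullWeight_north (k : ℕ) :
    ∫⁻ b, ∫⁻ c, hullWeight k (EuclideanSpace.single 2 1) b c ∂sphereUniform ∂sphereUniform =
      ENNReal.ofReal (6 * Real.pi / ((k + 2) * (k + 4) * (k + 6))) := by
  set e : E3 := EuclideanSpace.single 2 1
  have hpi := Real.pi_pos
  have hcm : Measurable fun b => ∫⁻ c, hullWeight k e b c ∂sphereUniform :=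
    Measurable.lintegral_prod_right' (f := fun z : E3 × E3 => hullWeight k e z.1 z.2)
      (measurable_hullWeight k measurable_const measurable_fst measurable_snd)
  have hc : ∀ b : E3, Measurable fun c => hullWeight k e b c := fun b =>
    measurable_hullWeight k measurable_const measurable_const measurable_id
  set H : ℝ → ℝ → ℝ → ℝ → ℝ≥0∞ := fun s q t r =>
    ENNReal.ofReal (1 / (Real.pi * (1 + s ^ 2 + q ^ 2) ^ 2)) *
        (ENNReal.ofReal (1 / (Real.pi * (1 + t ^ 2 + r ^ 2) ^ 2)) *
          hullWeight k e (stereo s q) (stereo t r)) with hH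
  have hHm : ∀ {α : Type} [MeasurableSpace α] {f g h i : α → ℝ}, Measurable f → Measurable g →
      Measurable h → Measurable i → Measurable fun x => H (f x) (g x) (h x) (i x) := by
    intro α _ f g h i hf hg hh hi
    exact Measurable.mul (by fun_prop) (Measurable.mul (by fun_prop)
      (measurable_hullWeight k measurable_const (measurable_stereo hf hg)
        (measurable_stereo hh hi)))
  set J : ℝ → ℝ → ℝ → ℝ → ℝ≥0∞ := fun s t m b =>
      ENNReal.ofReal (4 / Real.pi ^ 2 * (|b| * (|b| / √(1 + m ^ 2 + b ^ 2)) ^ k)) *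
        ENNReal.ofReal ((s - t) ^ 2 / (((1 + m ^ 2) * (s + m * b / (1 + m ^ 2)) ^ 2 +
          (1 + m ^ 2 + b ^ 2) / (1 + m ^ 2)) ^ 3 * ((1 + m ^ 2) * (t + m * b / (1 + m ^ 2)) ^ 2 +
          (1 + m ^ 2 + b ^ 2) / (1 + m ^ 2)) ^ 3)) with hJ
  have htriple : ∫⁻ b, ∫⁻ c, hullWeight k e b c ∂sphereUniform ∂sphereUniform =
      ∫⁻ s, ∫⁻ q, ∫⁻ t, ∫⁻ r, H s q t r := by
    rw [lintegral_sphereUniform hcm]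
    refine lintegral_congr fun s => lintegral_congr fun q => ?_
    rw [lintegral_sphereUniform (hc _), ← lintegral_const_mul' _ _ (by simp)]
    refine lintegral_congr fun t => ?_
    rw [← lintegral_const_mul' _ _ (by simp)]
  have hline : ∀ s, ∫⁻ q, ∫⁻ t, ∫⁻ r, H s q t r = ∫⁻ t, ∫⁻ m, ∫⁻ b, J s t m b := by
    intro s
    have hm : Measurable (Function.uncurry fun q t => ∫⁻ r, H s q t r) :=
      Measurable.lintegral_prod_right' (f := fun z : (ℝ × ℝ) × ℝ => H s z.1.1 z.1.2 z.2)
        (hHm (by fun_prop) (by fun_prop) (by fun_prop) (by fun_prop))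
    rw [lintegral_lintegral_swap hm.aemeasurable]
    refine lintegral_congr_ae ?_
    filter_upwards [Measure.ae_ne volume s] with t ht
    rw [lintegral_lintegral_line (f := fun q r => H s q t r)
      (hHm (by fun_prop) (by fun_prop) (by fun_prop) (by fun_prop)) ht]
    exact lintegral_congr fun m => lintegral_congr fun b => hullWeight_north_stereo k ht m b
  have hchord : ∀ m b, ∫⁻ s, ∫⁻ t, J s t m b = ENNReal.ofReal (3 / 8 *
      ((1 + m ^ 2) ^ 2 / (1 + m ^ 2 + b ^ 2) ^ 4 * (|b| * (|b| / √(1 + m ^ 2 + b ^ 2)) ^ k))) := by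
    intro m b
    simp only [hJ]
    simp_rw [lintegral_const_mul' (ENNReal.ofReal (4 / Real.pi ^ 2 *
      (|b| * (|b| / √(1 + m ^ 2 + b ^ 2)) ^ k))) _ ENNReal.ofReal_ne_top]
    rw [lintegral_lintegral_sq_sub_div_affine _ (by positivity) (by positivity),
      ← ENNReal.ofReal_mul (by positivity)]
    congr 1
    generalize (|b| / √(1 + m ^ 2 + b ^ 2)) ^ k = x
    field_simp
    ring
  have hoffset : ∀ m : ℝ, ∫⁻ b : ℝ, ENNReal.ofReal (3 / 8 *
      ((1 + m ^ 2) ^ 2 / (1 + m ^ 2 + b ^ 2) ^ 4 * (|b| * (|b| / √(1 + m ^ 2 + b ^ 2)) ^ k))) =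
      ENNReal.ofReal ((1 + m ^ 2)⁻¹) *
        ENNReal.ofReal (3 / 8 * (16 / ((k + 2) * (k + 4) * (k + 6)))) := by
    intro m
    have ha : 0 < √(1 + m ^ 2) := by positivity
    rw [lintegral_eq_mul_comp_mul_left _ ha.ne', ENNReal.ofReal_mul (by norm_num : (0:ℝ) ≤ 3 / 8),
      ← lintegral_radial k, ← lintegral_const_mul' _ _ ENNReal.ofReal_ne_top,
      ← lintegral_const_mul' _ _ ENNReal.ofReal_ne_top,
      ← lintegral_const_mul' _ _ ENNReal.ofReal_ne_top]
    refine lintegral_congr fun v => ?_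
    have hsq : √(1 + m ^ 2) ^ 2 = 1 + m ^ 2 := Real.sq_sqrt (by positivity)
    have h1 : 1 + m ^ 2 + (√(1 + m ^ 2) * v) ^ 2 = (1 + m ^ 2) * (1 + v ^ 2) := by
      rw [mul_pow, hsq]; ring
    have h2 : |√(1 + m ^ 2) * v| / √((1 + m ^ 2) * (1 + v ^ 2)) = |v| / √(1 + v ^ 2) := by
      rw [Real.sqrt_mul (by positivity), abs_mul, abs_of_pos ha, mul_div_mul_left _ _ ha.ne']
    rw [h1, h2, abs_mul, abs_of_pos ha, ← ENNReal.ofReal_mul (by positivity),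
      ← ENNReal.ofReal_mul (by positivity), ← ENNReal.ofReal_mul (by positivity)]
    congr 1
    generalize (|v| / √(1 + v ^ 2)) ^ k = x
    have : √(1 + m ^ 2) * √(1 + m ^ 2) = 1 + m ^ 2 := by rw [← sq, hsq]
    rw [show √(1 + m ^ 2) * (3 / 8 * ((1 + m ^ 2) ^ 2 / ((1 + m ^ 2) * (1 + v ^ 2)) ^ 4 *
      (√(1 + m ^ 2) * |v| * x))) = (√(1 + m ^ 2) * √(1 + m ^ 2)) * (3 / 8 * ((1 + m ^ 2) ^ 2 /
      ((1 + m ^ 2) * (1 + v ^ 2)) ^ 4 * (|v| * x))) by ring, this]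
    field_simp
  rw [htriple]
  simp only [hline]
  rw [lintegral_lintegral_comm₄]
  · simp only [hchord, hoffset]
    rw [lintegral_mul_const' _ _ ENNReal.ofReal_ne_top, lintegral_inv_one_add_sq,
      ← ENNReal.ofReal_mul hpi.le]
    congr 1
    ring
  · simp only [hJ]
    fun_prop

theorem lintegral_hullWeight (k : ℕ) :
    ∫⁻ a, ∫⁻ b, ∫⁻ c, hullWeight k a b c ∂sphereUniform ∂sphereUniform ∂sphereUniform =
      ENNReal.ofReal (6 * Real.pi / ((k + 2) * (k + 4) * (k + 6))) := by
  rw [← lintegral_hullWeight_north k]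
  trans ∫⁻ _ : E3, (∫⁻ b, ∫⁻ c, hullWeight k (EuclideanSpace.single 2 1) b c
    ∂sphereUniform ∂sphereUniform) ∂sphereUniform
  · refine lintegral_congr_ae ?_
    filter_upwards [ae_norm_eq_one_sphereUniform] with a ha
    obtain ⟨R, hR⟩ := exists_linearIsometryEquiv_apply_eq (v := a)
      (w := EuclideanSpace.single 2 1) (by simp [ha])
    have hcm : ∀ a, Measurable fun b => ∫⁻ c, hullWeight k a b c ∂sphereUniform := fun a =>
      Measurable.lintegral_prod_right' (f := fun z : E3 × E3 => hullWeight k a z.1 z.2)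
        (measurable_hullWeight k measurable_const measurable_fst measurable_snd)
    have hc : ∀ a b : E3, Measurable fun c => hullWeight k a b c := fun a b =>
      measurable_hullWeight k measurable_const measurable_const measurable_id
    rw [← hR, ← (measurePreserving_sphereUniform R).lintegral_comp (hcm (R a))]
    refine lintegral_congr fun b => ?_
    rw [← (measurePreserving_sphereUniform R).lintegral_comp (hc (R a) (R b))]
    simp only [hullWeight_map]
  · simp

theorem lintegral_Ioi_ofReal_sub_pow (r : ℝ) {n : ℕ} (hn : n ≠ 0) :
    ∫⁻ b in Ioi (0 : ℝ), ENNReal.ofReal (r - b) ^ n =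
      ENNReal.ofReal (1 / (n + 1)) * ENNReal.ofReal r ^ (n + 1) := by
  rcases le_or_gt r 0 with hr | hr
  · rw [ENNReal.ofReal_of_nonpos hr, zero_pow (by lia), mul_zero]
    rw [setLIntegral_eq_zero_iff measurableSet_Ioi (by fun_prop)]
    refine ae_of_all _ fun b hb => ?_
    have hb : 0 < b := hb
    rw [ENNReal.ofReal_of_nonpos (by linarith), zero_pow hn]
  · have h1 : ∫⁻ b in Ioi (0 : ℝ), ENNReal.ofReal (r - b) ^ n =
        ∫⁻ b in Ioc 0 r, ENNReal.ofReal ((r - b) ^ n) := by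
      rw [← lintegral_indicator measurableSet_Ioi, ← lintegral_indicator measurableSet_Ioc]
      refine lintegral_congr fun b => ?_
      by_cases hb : 0 < b <;> by_cases hbr : b ≤ r
      · rw [indicator_of_mem (show b ∈ Ioi 0 from hb), indicator_of_mem (show b ∈ Ioc 0 r from
          ⟨hb, hbr⟩), ENNReal.ofReal_pow (by linarith)]
      · rw [indicator_of_mem (show b ∈ Ioi 0 from hb), indicator_of_notMem (fun h => hbr h.2),
          ENNReal.ofReal_of_nonpos (by linarith), zero_pow hn]
      · rw [indicator_of_notMem (show b ∉ Ioi 0 from hb), indicator_of_notMem (fun h => hb h.1)]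
      · rw [indicator_of_notMem (show b ∉ Ioi 0 from hb), indicator_of_notMem (fun h => hb h.1)]
    rw [h1, ← ofReal_integral_eq_lintegral_ofReal, ← intervalIntegral.integral_of_le hr.le]
    · have hF : ∀ b : ℝ, HasDerivAt (fun b => -((r - b) ^ (n + 1) / (n + 1))) ((r - b) ^ n) b := by
        intro b
        have := ((((hasDerivAt_id b).const_sub r).fun_pow (n + 1)).div_const ((n : ℝ) + 1)).fun_neg
        refine this.congr_deriv ?_
        have : (n : ℝ) + 1 ≠ 0 := by positivity
        simp
        field_simp
      rw [intervalIntegral.integral_eq_sub_of_hasDerivAt (fun b _ => hF b)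
        (Continuous.intervalIntegrable (by fun_prop) _ _), ← ENNReal.ofReal_pow hr.le,
        ← ENNReal.ofReal_mul (by positivity)]
      congr 1
      simp
      ring
    · exact (Continuous.integrableOn_Icc (by fun_prop)).mono_set Ioc_subset_Icc_self
    · filter_upwards [ae_restrict_mem measurableSet_Ioc] with u hu
      have : 0 ≤ r - u := by linarith [hu.2]
      positivity

theorem volume_standard_simplex :
    volume {x : E3 | 0 < x 0 ∧ 0 < x 1 ∧ 0 < x 2 ∧ x 0 + x 1 + x 2 ≤ 1} =
      ENNReal.ofReal (1 / 6) := by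
  have hx : ∀ i, Measurable fun x : E3 => x i := fun i => by fun_prop
  have hm : MeasurableSet {x : E3 | 0 < x 0 ∧ 0 < x 1 ∧ 0 < x 2 ∧ x 0 + x 1 + x 2 ≤ 1} :=
    (measurableSet_lt measurable_const (hx 0)).inter
      ((measurableSet_lt measurable_const (hx 1)).inter
      ((measurableSet_lt measurable_const (hx 2)).inter
        (measurableSet_le (((hx 0).add (hx 1)).add (hx 2)) measurable_const)))
  have key : ∀ a b c : ℝ,
      {x : E3 | 0 < x 0 ∧ 0 < x 1 ∧ 0 < x 2 ∧ x 0 + x 1 + x 2 ≤ 1}.indicator 1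
        (!₂[a, b, c] : E3) = (Ioi 0).indicator (fun a => (Ioi 0).indicator (fun b =>
          (Ioc 0 (1 - a - b)).indicator (fun _ => (1 : ℝ≥0∞)) c) b) a := by
    intro a b c
    have : a + b + c ≤ 1 ↔ c ≤ 1 - a - b := by constructor <;> intro h <;> linarith
    by_cases ha : 0 < a <;> by_cases hb : 0 < b <;>
      simp [indicator_apply, ha, hb, this]
  rw [← lintegral_indicator_one hm, lintegral_E3 (measurable_one.indicator hm)]
  simp only [key]
  have h1 : ∀ a b : ℝ, ∫⁻ c, (Ioi 0).indicator (fun a => (Ioi 0).indicator (fun b =>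
          (Ioc 0 (1 - a - b)).indicator (fun _ => (1 : ℝ≥0∞)) c) b) a =
      (Ioi 0).indicator (fun a => (Ioi 0).indicator (fun b =>
          ENNReal.ofReal (1 - a - b) ^ 1) b) a := by
    intro a b
    by_cases ha : 0 < a <;> by_cases hb : 0 < b
    · simp only [indicator_of_mem (show a ∈ Ioi 0 from ha), indicator_of_mem (show b ∈ Ioi 0 from hb)]
      rw [lintegral_indicator measurableSet_Ioc, setLIntegral_one, Real.volume_Ioc, sub_zero,
        pow_one]
    all_goals simp [indicator_apply, ha, hb]
  have h2 : ∀ a : ℝ, ∫⁻ b, (Ioi 0).indicator (fun a => (Ioi 0).indicator (fun b =>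
          ENNReal.ofReal (1 - a - b) ^ 1) b) a =
      (Ioi 0).indicator (fun a => ENNReal.ofReal (1 / 2) * ENNReal.ofReal (1 - a) ^ 2) a := by
    intro a
    by_cases ha : 0 < a
    · simp only [indicator_of_mem (show a ∈ Ioi 0 from ha)]
      rw [lintegral_indicator measurableSet_Ioi, lintegral_Ioi_ofReal_sub_pow _ one_ne_zero]
      norm_num
    · simp [indicator_apply, ha]
  simp only [h1, h2]
  rw [lintegral_indicator measurableSet_Ioi, lintegral_const_mul' _ _ ENNReal.ofReal_ne_top,
    lintegral_Ioi_ofReal_sub_pow _ two_ne_zero, ← ENNReal.ofReal_pow zero_le_one,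
    ← ENNReal.ofReal_mul (by positivity), ← ENNReal.ofReal_mul (by positivity)]
  norm_num

/-- The simplex with vertices `0, a, b, c`, with the faces through `0` removed. -/
def coneSimplex (a b c : E3) : Set E3 :=
  {x | 0 < det3 x b c / det3 a b c ∧ 0 < det3 a x c / det3 a b c ∧ 0 < det3 a b x / det3 a b c ∧
    inner ℝ (planeNormal a b c) x / det3 a b c ≤ 1}

theorem measurableSet_coneSimplex (a b c : E3) : MeasurableSet (coneSimplex a b c) := by
  have h1 : Measurable fun x => det3 x b c / det3 a b c :=
    (measurable_det3 measurable_id measurable_const measurable_const).div_const _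
  have h2 : Measurable fun x => det3 a x c / det3 a b c :=
    (measurable_det3 measurable_const measurable_id measurable_const).div_const _
  have h3 : Measurable fun x => det3 a b x / det3 a b c :=
    (measurable_det3 measurable_const measurable_const measurable_id).div_const _
  have h4 : Measurable fun x => inner ℝ (planeNormal a b c) x / det3 a b c := by fun_prop
  exact (measurableSet_lt measurable_const h1).inter ((measurableSet_lt measurable_const h2).inter
    ((measurableSet_lt measurable_const h3).inter (measurableSet_le h4 measurable_const)))

theorem mem_coneSimplex_iff {a b c : E3} (hd : det3 a b c ≠ 0) {x : E3} :
    x ∈ coneSimplex a b c ↔ ∃ u v w : ℝ, 0 < u ∧ 0 < v ∧ 0 < w ∧ u + v + w ≤ 1 ∧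
      u • a + v • b + w • c = x := by
  constructor
  · rintro ⟨h1, h2, h3, h4⟩
    refine ⟨_, _, _, h1, h2, h3, ?_, ?_⟩
    · rw [inner_planeNormal, add_div, add_div] at h4
      exact h4
    · apply smul_right_injective E3 hd
      simp only [smul_add, smul_smul, mul_div_cancel₀ _ hd]
      exact (det3_smul_eq a b c x).symm
  · rintro ⟨u, v, w, hu, hv, hw, h, rfl⟩
    have e1 : det3 (u • a + v • b + w • c) b c = u * det3 a b c := by simp [det3]; ring
    have e2 : det3 a (u • a + v • b + w • c) c = v * det3 a b c := by simp [det3]; ring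
    have e3 : det3 a b (u • a + v • b + w • c) = w * det3 a b c := by simp [det3]; ring
    refine ⟨?_, ?_, ?_, ?_⟩
    · rwa [e1, mul_div_cancel_right₀ _ hd]
    · rwa [e2, mul_div_cancel_right₀ _ hd]
    · rwa [e3, mul_div_cancel_right₀ _ hd]
    · rwa [inner_planeNormal, e1, e2, e3, ← add_mul, ← add_mul, mul_div_cancel_right₀ _ hd]

theorem volume_coneSimplex (a b c : E3) :
    volume (coneSimplex a b c) = ENNReal.ofReal (|det3 a b c| / 6) := by
  rcases eq_or_ne (det3 a b c) 0 with hd | hd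
  · have : coneSimplex a b c = ∅ := by
      ext x
      simp [coneSimplex, hd]
    simp [this, hd]
  · set M : Matrix (Fin 3) (Fin 3) ℝ := !![a 0, b 0, c 0; a 1, b 1, c 1; a 2, b 2, c 2]
    set L := Matrix.toLpLin 2 2 M
    have hL : ∀ x : E3, L x = x 0 • a + x 1 • b + x 2 • c := by
      intro x
      ext i
      fin_cases i <;> 
        simp [L, M, Matrix.toLpLin_apply, dotProduct, Fin.sum_univ_three] <;> ring
    have hdet : LinearMap.det L = det3 a b c := by
      rw [LinearMap.det_toLpLin, Matrix.det_fin_three]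
      simp [M, det3]
      ring
    have himg : coneSimplex a b c =
        L '' {x : E3 | 0 < x 0 ∧ 0 < x 1 ∧ 0 < x 2 ∧ x 0 + x 1 + x 2 ≤ 1} := by
      ext x
      rw [mem_coneSimplex_iff hd]
      constructor
      · rintro ⟨u, v, w, hu, hv, hw, h, rfl⟩
        exact ⟨!₂[u, v, w], ⟨hu, hv, hw, h⟩, hL _⟩
      · rintro ⟨y, ⟨h0, h1, h2, h3⟩, rfl⟩
        exact ⟨_, _, _, h0, h1, h2, h3, (hL y).symm⟩
    rw [himg, Measure.addHaar_image_linearMap, hdet, volume_standard_simplex,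
      ← ENNReal.ofReal_mul (abs_nonneg _), mul_one_div]

/-- The sign `±1` encoded by a Boolean. -/
def boolSign (s : Bool) : ℝ := cond s 1 (-1)

theorem boolSign_mul_self (s : Bool) : boolSign s * boolSign s = 1 := by
  cases s <;> simp [boolSign]

theorem abs_boolSign (s : Bool) : |boolSign s| = 1 := by
  cases s <;> simp [boolSign]

theorem exists_boolSign_mul_abs (r : ℝ) : ∃ s, r = boolSign s * |r| := by
  rcases le_total 0 r with h | h
  · exact ⟨true, by simp [boolSign, abs_of_nonneg h]⟩
  · exact ⟨false, by simp [boolSign, abs_of_nonpos h]⟩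

theorem det3_smul (s t u : ℝ) (a b c : E3) :
    det3 (s • a) (t • b) (u • c) = s * t * u * det3 a b c := by
  simp [det3]; ring

theorem det3_swap_left (a b c : E3) : det3 b a c = -det3 a b c := by simp [det3]; ring

theorem det3_swap_right (a b c : E3) : det3 a c b = -det3 a b c := by simp [det3]; ring

theorem det3_eq_zero_of_mem_span {s : Set E3} (h : ∀ a ∈ s, ∀ b ∈ s, ∀ c ∈ s, det3 a b c = 0)
    {a b c : E3} (ha : a ∈ Submodule.span ℝ s) (hb : b ∈ Submodule.span ℝ s)
    (hc : c ∈ Submodule.span ℝ s) : det3 a b c = 0 := by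
  have h1 : ∀ a ∈ Submodule.span ℝ s, ∀ b ∈ s, ∀ c ∈ s, det3 a b c = 0 := by
    intro a ha b hb c hc
    induction ha using Submodule.span_induction with
    | mem x hx => exact h x hx b hb c hc
    | zero => simp [det3]
    | add x y _ _ hx hy =>
      have : det3 (x + y) b c = det3 x b c + det3 y b c := by simp [det3]; ring
      rw [this, hx, hy, add_zero]
    | smul r x _ hx =>
      have : det3 (r • x) b c = r * det3 x b c := by simp [det3]; ring
      rw [this, hx, mul_zero]
  have h2 : ∀ a ∈ Submodule.span ℝ s, ∀ b ∈ Submodule.span ℝ s, ∀ c ∈ s, det3 a b c = 0 := by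
    intro a ha b hb c hc
    induction hb using Submodule.span_induction with
    | mem x hx => exact h1 a ha x hx c hc
    | zero => simp [det3]
    | add x y _ _ hx hy =>
      have : det3 a (x + y) c = det3 a x c + det3 a y c := by simp [det3]; ring
      rw [this, hx, hy, add_zero]
    | smul r x _ hx =>
      have : det3 a (r • x) c = r * det3 a x c := by simp [det3]; ring
      rw [this, hx, mul_zero]
  induction hc using Submodule.span_induction with
  | mem x hx => exact h2 a ha b hb x hx
  | zero => simp [det3]
  | add x y _ _ hx hy =>
    have : det3 a b (x + y) = det3 a b x + det3 a b y := by simp [det3]; ring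
    rw [this, hx, hy, add_zero]
  | smul r x _ hx =>
    have : det3 a b (r • x) = r * det3 a b x := by simp [det3]; ring
    rw [this, hx, mul_zero]

variable {n : ℕ}

theorem exists_orderEmbedding_det3_ne_zero {X : Fin n → E3} {S : Set (Fin n)}
    (hS : Submodule.span ℝ (X '' S) = ⊤) :
    ∃ f : Fin 3 ↪o Fin n, (∀ j, f j ∈ S) ∧ det3 (X (f 0)) (X (f 1)) (X (f 2)) ≠ 0 := by
  by_contra! hcon
  have h1 : ∀ i ∈ S, ∀ j ∈ S, ∀ k ∈ S, i < j → j < k → det3 (X i) (X j) (X k) = 0 := by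
    intro i hi j hj k hk hij hjk
    have hm : StrictMono ![i, j, k] := by
      rw [Fin.strictMono_iff_lt_succ]
      intro l
      fin_cases l <;> simpa
    refine hcon (OrderEmbedding.ofStrictMono _ hm) fun l => ?_
    fin_cases l <;> simpa
  have h2 : ∀ a ∈ X '' S, ∀ b ∈ X '' S, ∀ c ∈ X '' S, det3 a b c = 0 := by
    rintro _ ⟨i, hi, rfl⟩ _ ⟨j, hj, rfl⟩ _ ⟨k, hk, rfl⟩
    rcases lt_trichotomy i j with hij | rfl | hij
    · rcases lt_trichotomy j k with hjk | rfl | hjk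
      · exact h1 i hi j hj k hk hij hjk
      · exact det3_self_right _ _
      · rw [det3_swap_right]
        rcases lt_trichotomy i k with hik | rfl | hik
        · rw [h1 i hi k hk j hj hik hjk, neg_zero]
        · rw [det3_self_left, neg_zero]
        · rw [det3_swap_left, h1 k hk i hi j hj hik hij, neg_zero, neg_zero]
    · exact det3_self_left _ _
    · rw [det3_swap_left]
      rcases lt_trichotomy i k with hik | rfl | hik
      · rw [h1 j hj i hi k hk hij hik, neg_zero]
      · rw [det3_self_right, neg_zero]
      · rw [det3_swap_right]
        rcases lt_trichotomy j k with hjk | rfl | hjk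
        · rw [h1 j hj k hk i hi hjk hik, neg_zero, neg_zero]
        · rw [det3_self_left, neg_zero, neg_zero]
        · rw [det3_swap_left, h1 k hk j hj i hi hjk hij, neg_zero, neg_zero, neg_zero]
  have h3 := det3_eq_zero_of_mem_span h2 (a := EuclideanSpace.single 0 1)
    (b := EuclideanSpace.single 1 1) (c := EuclideanSpace.single 2 1)
    (by simp [hS]) (by simp [hS]) (by simp [hS])
  simp [det3] at h3

/-- The signed points selected by an index triple and a choice of signs. -/
def signedPoint (X : Fin n → E3) (f : Fin 3 ↪o Fin n) (ε : Fin 3 → Bool) (j : Fin 3) : E3 :=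
  boolSign (ε j) • X (f j)

/-- The determinant of the three signed points. -/
def facetDet (X : Fin n → E3) (f : Fin 3 ↪o Fin n) (ε : Fin 3 → Bool) : ℝ :=
  det3 (signedPoint X f ε 0) (signedPoint X f ε 1) (signedPoint X f ε 2)

/-- The normal vector of the plane through the three signed points. -/
noncomputable def facetNormal (X : Fin n → E3) (f : Fin 3 ↪o Fin n) (ε : Fin 3 → Bool) : E3 :=
  planeNormal (signedPoint X f ε 0) (signedPoint X f ε 1) (signedPoint X f ε 2)

/-- The three signed points span a facet of the symmetric convex hull. -/
def IsHullFacet (X : Fin n → E3) (f : Fin 3 ↪o Fin n) (ε : Fin 3 → Bool) : Prop :=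
  ∀ l ∉ range f, |inner ℝ (facetNormal X f ε) (X l)| ≤ |facetDet X f ε|

/-- No further point or reflected point lies in the plane through three signed points. -/
def IsGenericConfig (X : Fin n → E3) : Prop :=
  ∀ (f : Fin 3 ↪o Fin n) (ε : Fin 3 → Bool), ∀ l ∉ range f, facetDet X f ε ≠ 0 →
    |inner ℝ (facetNormal X f ε) (X l)| ≠ |facetDet X f ε|

/-- The simplex with apex `0` over the three signed points. -/
def facetCone (X : Fin n → E3) (f : Fin 3 ↪o Fin n) (ε : Fin 3 → Bool) : Set E3 :=
  coneSimplex (signedPoint X f ε 0) (signedPoint X f ε 1) (signedPoint X f ε 2)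

theorem facetDet_ne_zero_of_mem {X : Fin n → E3} {f : Fin 3 ↪o Fin n} {ε : Fin 3 → Bool} {x : E3}
    (hx : x ∈ facetCone X f ε) : facetDet X f ε ≠ 0 := by
  intro h
  have := hx.1
  simp only [facetDet] at h
  simp [h] at this

theorem mem_facetCone_iff {X : Fin n → E3} {f : Fin 3 ↪o Fin n} {ε : Fin 3 → Bool} {x : E3}
    (hd : facetDet X f ε ≠ 0) :
    x ∈ facetCone X f ε ↔ ∃ u : Fin 3 → ℝ, (∀ j, 0 < u j) ∧ ∑ j, u j ≤ 1 ∧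
      ∑ j, u j • signedPoint X f ε j = x := by
  rw [facetCone, mem_coneSimplex_iff hd]
  simp only [Fin.sum_univ_three]
  constructor
  · rintro ⟨u, v, w, hu, hv, hw, h⟩
    refine ⟨![u, v, w], fun j => ?_, h⟩
    fin_cases j <;> assumption
  · rintro ⟨u, hu, h⟩
    exact ⟨u 0, u 1, u 2, hu 0, hu 1, hu 2, h⟩

theorem inner_facetNormal_signedPoint (X : Fin n → E3) (f : Fin 3 ↪o Fin n) (ε : Fin 3 → Bool)
    (j : Fin 3) : inner ℝ (facetNormal X f ε) (signedPoint X f ε j) = facetDet X f ε := by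
  rw [facetNormal, inner_planeNormal, facetDet]
  fin_cases j <;> simp [det3_self_left, det3_self_mid, det3_self_right]

theorem abs_inner_facetNormal (X : Fin n → E3) (f : Fin 3 ↪o Fin n) (ε : Fin 3 → Bool)
    (j : Fin 3) : |inner ℝ (facetNormal X f ε) (X (f j))| = |facetDet X f ε| := by
  rw [← inner_facetNormal_signedPoint X f ε j, signedPoint, inner_smul_right, abs_mul,
    abs_boolSign, one_mul]

theorem IsHullFacet.abs_inner_le {X : Fin n → E3} {f : Fin 3 ↪o Fin n} {ε : Fin 3 → Bool}
    (h : IsHullFacet X f ε) (l : Fin n) :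
    |inner ℝ (facetNormal X f ε) (X l)| ≤ |facetDet X f ε| := by
  by_cases hl : l ∈ range f
  · obtain ⟨j, rfl⟩ := hl
    exact (abs_inner_facetNormal X f ε j).le
  · exact h l hl

theorem IsHullFacet.inner_div_le {X : Fin n → E3} {f g : Fin 3 ↪o Fin n} {ε δ : Fin 3 → Bool}
    (h : IsHullFacet X f ε) (j : Fin 3) :
    inner ℝ (facetNormal X f ε) (signedPoint X g δ j) / facetDet X f ε ≤ 1 := by
  refine (le_abs_self _).trans ?_
  rw [abs_div, signedPoint, inner_smul_right, abs_mul, abs_boolSign, one_mul]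
  exact div_le_one_of_le₀ (h.abs_inner_le _) (abs_nonneg _)

theorem eq_of_mem_facetCone {X : Fin n → E3} (hX : IsGenericConfig X) {f g : Fin 3 ↪o Fin n}
    {ε δ : Fin 3 → Bool} (hf : IsHullFacet X f ε) (hg : IsHullFacet X g δ) {x : E3}
    (hxf : x ∈ facetCone X f ε) (hxg : x ∈ facetCone X g δ) : f = g ∧ ε = δ := by
  have hdf := facetDet_ne_zero_of_mem hxf
  have hdg := facetDet_ne_zero_of_mem hxg
  obtain ⟨u, hu, -, hux⟩ := (mem_facetCone_iff hdf).1 hxf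
  obtain ⟨v, hv, -, hvx⟩ := (mem_facetCone_iff hdg).1 hxg
  have heval : ∀ (F : Fin 3 ↪o Fin n) (η : Fin 3 → Bool) (w : Fin 3 → ℝ) (G : Fin 3 ↪o Fin n)
      (θ : Fin 3 → Bool), ∑ j, w j • signedPoint X G θ j = x →
      inner ℝ (facetNormal X F η) x / facetDet X F η =
        ∑ j, w j * (inner ℝ (facetNormal X F η) (signedPoint X G θ j) / facetDet X F η) := by
    intro F η w G θ h
    rw [← h, inner_sum, Finset.sum_div]
    refine Finset.sum_congr rfl fun j _ => ?_
    rw [inner_smul_right, mul_div_assoc]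
  have hff := heval f ε u f ε hux
  have hgg := heval g δ v g δ hvx
  simp only [inner_facetNormal_signedPoint, div_self hdf, mul_one] at hff
  simp only [inner_facetNormal_signedPoint, div_self hdg, mul_one] at hgg
  have hfg := heval f ε v g δ hvx
  have hgf := heval g δ u f ε hux
  have hle1 : inner ℝ (facetNormal X f ε) x / facetDet X f ε ≤ ∑ j, v j := by
    rw [hfg]
    exact Finset.sum_le_sum fun j _ => mul_le_of_le_one_right (hv j).le (hf.inner_div_le j)
  have hsum : ∑ j, u j * (inner ℝ (facetNormal X g δ) (signedPoint X f ε j) / facetDet X g δ) =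
      ∑ j, u j := by
    refine le_antisymm
      (Finset.sum_le_sum fun j _ => mul_le_of_le_one_right (hu j).le (hg.inner_div_le j)) ?_
    linarith
  have hone : ∀ j, inner ℝ (facetNormal X g δ) (signedPoint X f ε j) / facetDet X g δ = 1 := by
    intro j
    have := (Finset.sum_eq_sum_iff_of_le fun j _ =>
      mul_le_of_le_one_right (hu j).le (hg.inner_div_le j)).1 hsum j (Finset.mem_univ j)
    exact mul_left_cancel₀ (hu j).ne' (this.trans (mul_one _).symm)
  have hone' : ∀ j, inner ℝ (facetNormal X g δ) (signedPoint X f ε j) = facetDet X g δ := by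
    intro j
    have := hone j
    rwa [div_eq_one_iff_eq hdg] at this
  have hsub : range f ⊆ range g := by
    rintro _ ⟨j, rfl⟩
    by_contra hj
    refine hX g δ _ hj hdg ?_
    rw [← hone' j, signedPoint, inner_smul_right, abs_mul, abs_boolSign, one_mul]
  have hrange : range f = range g := by
    refine Set.eq_of_subset_of_ncard_le hsub ?_ (finite_range g)
    rw [← image_univ, ← image_univ, ncard_image_of_injective _ f.injective,
      ncard_image_of_injective _ g.injective]
  have hfg' : f = g := by
    apply DFunLike.coe_injective
    exact (StrictMono.range_inj f.strictMono g.strictMono).1 hrange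
  subst hfg'
  refine ⟨rfl, funext fun j => ?_⟩
  by_contra hne
  have h1 := hone' j
  rw [← inner_facetNormal_signedPoint X f δ j, signedPoint, signedPoint, inner_smul_right,
    inner_smul_right] at h1
  have h2 : inner ℝ (facetNormal X f δ) (X (f j)) ≠ 0 := by
    rw [← abs_pos, abs_inner_facetNormal]
    exact abs_pos.2 hdg
  have h3 := mul_right_cancel₀ h2 h1
  revert hne h3
  cases ε j <;> cases δ j <;> simp [boolSign] <;> norm_num

theorem exists_sum_smul_of_mem_convexHull {X : Fin n → E3} {x : E3}
    (hx : x ∈ convexHull ℝ (range X ∪ -range X)) :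
    ∃ c : Fin n → ℝ, ∑ i, c i • X i = x ∧ ∑ i, |c i| ≤ 1 := by
  have hconv : Convex ℝ {x : E3 | ∃ c : Fin n → ℝ, ∑ i, c i • X i = x ∧ ∑ i, |c i| ≤ 1} := by
    rintro _ ⟨c, rfl, hc⟩ _ ⟨d, rfl, hd⟩ a b ha hb hab
    refine ⟨fun i => a * c i + b * d i, ?_, ?_⟩
    · simp only [Finset.smul_sum, smul_smul, add_smul, Finset.sum_add_distrib]
    · calc ∑ i, |a * c i + b * d i| ≤ ∑ i, (a * |c i| + b * |d i|) := by
            refine Finset.sum_le_sum fun i _ => (abs_add_le _ _).trans_eq ?_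
            rw [abs_mul, abs_mul, abs_of_nonneg ha, abs_of_nonneg hb]
        _ = a * ∑ i, |c i| + b * ∑ i, |d i| := by
            rw [Finset.sum_add_distrib, Finset.mul_sum, Finset.mul_sum]
        _ ≤ 1 := by nlinarith
  refine convexHull_min ?_ hconv hx
  rintro y (⟨i, rfl⟩ | ⟨i, hi⟩)
  · refine ⟨Pi.single i 1, ?_, ?_⟩
    · simp [Pi.single_apply, ite_smul]
    · simp [Pi.single_apply, apply_ite abs]
  · refine ⟨Pi.single i (-1), ?_, ?_⟩
    · simp [Pi.single_apply, ite_smul, hi]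
    · simp [Pi.single_apply, apply_ite abs]

theorem facetCone_subset_convexHull (X : Fin n → E3) (f : Fin 3 ↪o Fin n) (ε : Fin 3 → Bool) :
    facetCone X f ε ⊆ convexHull ℝ (range X ∪ -range X) := by
  intro x hx
  obtain ⟨u, hu, hu1, rfl⟩ := (mem_facetCone_iff (facetDet_ne_zero_of_mem hx)).1 hx
  have hsub := subset_convexHull ℝ (range X ∪ -range X)
  have hpos : ∀ i, X i ∈ convexHull ℝ (range X ∪ -range X) := fun i =>
    hsub (Or.inl (mem_range_self i))
  have hneg : ∀ i, -X i ∈ convexHull ℝ (range X ∪ -range X) := fun i =>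
    hsub (Or.inr (by simp))
  have hmem : ∀ j, signedPoint X f ε j ∈ convexHull ℝ (range X ∪ -range X) := by
    intro j
    rw [signedPoint]
    cases ε j
    · simpa [boolSign] using hneg (f j)
    · simpa [boolSign] using hpos (f j)
  have h0 : (0 : E3) ∈ convexHull ℝ (range X ∪ -range X) := by
    have := convex_convexHull ℝ (range X ∪ -range X) (hpos (f 0)) (hneg (f 0))
      (by norm_num : (0 : ℝ) ≤ 1 / 2) (by norm_num : (0 : ℝ) ≤ 1 / 2) (by norm_num)
    simpa using this
  have := (convex_convexHull ℝ (range X ∪ -range X)).sum_mem (t := Finset.univ)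
    (w := fun o : Option (Fin 3) => o.elim (1 - ∑ j, u j) u)
    (z := fun o => o.elim 0 (signedPoint X f ε)) ?_ ?_ ?_
  · simpa [Fintype.sum_option] using this
  · rintro (_ | j) -
    · simpa using hu1
    · exact (hu j).le
  · simp [Fintype.sum_option]
  · rintro (_ | j) -
    · exact h0
    · exact hmem j

/-- Existence of a representation with coefficients of least total absolute value. -/
theorem exists_minimal_representation {X : Fin n → E3} {x : E3}
    (hx : x ∈ convexHull ℝ (range X ∪ -range X)) :
    ∃ c : Fin n → ℝ, ∑ i, c i • X i = x ∧ ∑ i, |c i| ≤ 1 ∧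
      ∀ d : Fin n → ℝ, ∑ i, d i • X i = x → ∑ i, |c i| ≤ ∑ i, |d i| := by
  set C : Set (Fin n → ℝ) := {c | ∑ i, c i • X i = x ∧ ∑ i, |c i| ≤ 1}
  have hcl : IsClosed C :=
    (isClosed_eq (f := fun c : Fin n → ℝ => ∑ i, c i • X i) (by fun_prop) continuous_const).inter
      (isClosed_le (f := fun c : Fin n → ℝ => ∑ i, |c i|) (by fun_prop) continuous_const)
  have hsub : C ⊆ Icc (fun _ => -1) (fun _ => 1) := by
    intro c hc
    have : ∀ i, |c i| ≤ 1 := fun i =>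
      (Finset.single_le_sum (fun i _ => abs_nonneg (c i)) (Finset.mem_univ i)).trans hc.2
    exact ⟨fun i => (abs_le.1 (this i)).1, fun i => (abs_le.1 (this i)).2⟩
  obtain ⟨c, hc, hmin⟩ := (isCompact_Icc.of_isClosed_subset hcl hsub).exists_isMinOn
    (exists_sum_smul_of_mem_convexHull hx) (f := fun c : Fin n → ℝ => ∑ i, |c i|)
    (Continuous.continuousOn (by fun_prop))
  refine ⟨c, hc.1, hc.2, fun d hd => ?_⟩
  rcases le_or_gt (∑ i, |d i|) 1 with h | h
  · exact hmin ⟨hd, h⟩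
  · exact hc.2.trans h.le

theorem sum_eq_sum_orderEmbedding {M : Type*} [AddCommMonoid M] (f : Fin 3 ↪o Fin n)
    {g : Fin n → M} (hg : ∀ i ∉ range f, g i = 0) : ∑ i, g i = ∑ j, g (f j) := by
  have hmap := Finset.sum_map Finset.univ f.toEmbedding g
  refine Eq.trans ?_ hmap
  refine (Finset.sum_subset (Finset.subset_univ _) fun i _ hi => hg i ?_).symm
  simpa using hi

theorem sum_eq_add_sum_orderEmbedding {M : Type*} [AddCommMonoid M] (f : Fin 3 ↪o Fin n)
    {l : Fin n} (hl : l ∉ range f) {g : Fin n → M} (hg : ∀ i ∉ range f, i ≠ l → g i = 0) :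
    ∑ i, g i = g l + ∑ j, g (f j) := by
  classical
  rw [← Finset.add_sum_erase _ _ (Finset.mem_univ l)]
  congr 1
  have hmap := Finset.sum_map Finset.univ f.toEmbedding g
  refine Eq.trans ?_ hmap
  refine (Finset.sum_subset (fun i hi => ?_) fun i hi hif => hg i ?_ ?_).symm
  · simp only [Finset.mem_map, Finset.mem_univ, true_and] at hi
    obtain ⟨j, rfl⟩ := hi
    refine Finset.mem_erase.2 ⟨fun h => hl ⟨j, h⟩, Finset.mem_univ _⟩
  · simpa using hif
  · exact (Finset.mem_erase.1 hi).1

theorem exists_isHullFacet_mem {X : Fin n → E3} (hX : IsGenericConfig X) {x : E3}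
    (hx : x ∈ convexHull ℝ (range X ∪ -range X))
    (hspan : ∀ S : Set (Fin n), Submodule.span ℝ (X '' S) ≠ ⊤ → x ∉ Submodule.span ℝ (X '' S)) :
    ∃ f ε, IsHullFacet X f ε ∧ x ∈ facetCone X f ε := by
  classical
  obtain ⟨c, hcx, hc1, hmin⟩ := exists_minimal_representation hx
  have hS : Submodule.span ℝ (X '' {i | c i ≠ 0}) = ⊤ := by
    by_contra h
    refine hspan _ h ?_
    rw [← hcx]
    refine Submodule.sum_mem _ fun i _ => ?_
    by_cases hi : c i = 0
    · simp [hi]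
    · exact Submodule.smul_mem _ _ (Submodule.subset_span ⟨i, hi, rfl⟩)
  obtain ⟨f, hfS, hdet⟩ := exists_orderEmbedding_det3_ne_zero hS
  choose ε hε using fun j => exists_boolSign_mul_abs (c (f j))
  have hcpos : ∀ j, 0 < |c (f j)| := fun j => abs_pos.2 (hfS j)
  have hs0 : ∀ s, boolSign s ≠ 0 := fun s h => by simpa [h] using boolSign_mul_self s
  have hd : facetDet X f ε ≠ 0 := by
    simp only [facetDet, signedPoint, det3_smul]
    exact mul_ne_zero (mul_ne_zero (mul_ne_zero (hs0 _) (hs0 _)) (hs0 _)) hdet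
  -- expansion of an arbitrary vector in the basis of signed points
  have hexp : ∀ y : E3, ∃ a : Fin 3 → ℝ, ∑ j, a j • signedPoint X f ε j = y ∧
      ∑ j, a j = inner ℝ (facetNormal X f ε) y / facetDet X f ε := by
    intro y
    refine ⟨![det3 y (signedPoint X f ε 1) (signedPoint X f ε 2) / facetDet X f ε,
      det3 (signedPoint X f ε 0) y (signedPoint X f ε 2) / facetDet X f ε,
      det3 (signedPoint X f ε 0) (signedPoint X f ε 1) y / facetDet X f ε], ?_, ?_⟩
    · apply smul_right_injective E3 hd
      simp only [Fin.sum_univ_three, smul_add, smul_smul]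
      simp [mul_div_cancel₀ _ hd]
      exact (det3_smul_eq _ _ _ y).symm
    · rw [facetNormal, inner_planeNormal, add_div, add_div, Fin.sum_univ_three]
      rfl
  have hkey : ∀ l ∉ range f, ∃ δ > 0, ∀ t : ℝ, |t| < δ →
      t * (inner ℝ (facetNormal X f ε) (X l) / facetDet X f ε) ≤ |c l + t| - |c l| := by
    intro l hl
    obtain ⟨a, hal, hasum⟩ := hexp (X l)
    rw [← hasum]
    have hev : ∀ᶠ t in 𝓝 (0 : ℝ), ∀ j, 0 < |c (f j)| - t * a j := by
      rw [eventually_all]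
      intro j
      have : Tendsto (fun t => |c (f j)| - t * a j) (𝓝 0) (𝓝 (|c (f j)| - 0 * a j)) :=
        Continuous.tendsto (by fun_prop) 0
      exact this.eventually_const_lt (by simpa using hcpos j)
    obtain ⟨δ, hδ, hball⟩ := Metric.eventually_nhds_iff.1 hev
    refine ⟨δ, hδ, fun t ht => ?_⟩
    have ht' := hball (y := t) (by simpa using ht)
    set w : Fin n → ℝ := fun i => if i = l then 1 else
      -∑ j, if f j = i then a j * boolSign (ε j) else 0 with hw
    have hwl : w l = 1 := by simp [hw]
    have hwf : ∀ j, w (f j) = -(a j * boolSign (ε j)) := by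
      intro j
      have : f j ≠ l := fun h => hl ⟨j, h⟩
      simp [hw, this]
    have hw0 : ∀ i ∉ range f, i ≠ l → w i = 0 := by
      intro i hi hil
      have : ∀ j, f j ≠ i := fun j h => hi ⟨j, h⟩
      simp [hw, hil, this]
    have hwX : ∑ i, w i • X i = 0 := by
      rw [sum_eq_add_sum_orderEmbedding f hl fun i hi hil => by rw [hw0 i hi hil, zero_smul], hwl,
        one_smul]
      simp only [hwf, neg_smul, Finset.sum_neg_distrib, mul_smul]
      rw [add_neg_eq_zero]
      exact hal.symm
    have h1 := hmin (fun i => c i + t * w i) (by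
      simp only [add_smul, mul_smul, Finset.sum_add_distrib]
      rw [← Finset.smul_sum, hwX, smul_zero, add_zero, hcx])
    rw [← sub_nonneg, ← Finset.sum_sub_distrib, sum_eq_add_sum_orderEmbedding f hl
      fun i hi hil => by rw [hw0 i hi hil, mul_zero, add_zero, sub_self]] at h1
    have h2 : ∀ j, |c (f j) + t * w (f j)| - |c (f j)| = -(t * a j) := by
      intro j
      have : c (f j) + t * w (f j) = boolSign (ε j) * (|c (f j)| - t * a j) := by
        rw [hwf]
        nth_rewrite 1 [hε j]
        ring
      rw [this, abs_mul, abs_boolSign, one_mul, abs_of_pos (ht' j)]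
      ring
    simp only [h2, hwl, mul_one, Finset.sum_neg_distrib, ← Finset.mul_sum] at h1
    linarith
  have hfacet : IsHullFacet X f ε := by
    intro l hl
    obtain ⟨δ, hδ, h⟩ := hkey l hl
    have hσ : |inner ℝ (facetNormal X f ε) (X l) / facetDet X f ε| ≤ 1 := by
      have h1 := h (δ / 2) (by rw [abs_of_pos] <;> linarith)
      have h2 := h (-(δ / 2)) (by rw [abs_neg, abs_of_pos] <;> linarith)
      have h3 := abs_add_le (c l) (δ / 2)
      have h4 := abs_add_le (c l) (-(δ / 2))
      rw [abs_neg] at h4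
      rw [abs_of_pos (by linarith : 0 < δ / 2)] at h3 h4
      rw [abs_le]
      constructor <;> nlinarith
    rwa [abs_div, div_le_one (abs_pos.2 hd)] at hσ
  have hc0 : ∀ l ∉ range f, c l = 0 := by
    intro l hl
    by_contra hcl
    obtain ⟨δ, hδ, h⟩ := hkey l hl
    refine hX f ε l hl hd ?_
    rw [← div_eq_one_iff_eq (abs_ne_zero.2 hd), ← abs_div]
    set σ := inner ℝ (facetNormal X f ε) (X l) / facetDet X f ε
    set m := min (δ / 2) |c l|
    have hm : 0 < m := lt_min (by linarith) (abs_pos.2 hcl)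
    have hm1 : m < δ := (min_le_left _ _).trans_lt (by linarith)
    have hm2 : m ≤ |c l| := min_le_right _ _
    have h1 := h m (by rwa [abs_of_pos hm])
    have h2 := h (-m) (by rwa [abs_neg, abs_of_pos hm])
    rcases lt_or_gt_of_ne hcl with hneg | hpos
    · rw [abs_of_neg hneg] at h1 h2 hm2
      rw [abs_of_nonpos (by linarith)] at h1 h2
      have : σ = -1 := by
        apply le_antisymm <;> nlinarith
      simp [this]
    · rw [abs_of_pos hpos] at h1 h2 hm2
      rw [abs_of_nonneg (by linarith)] at h1 h2
      have : σ = 1 := by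
        apply le_antisymm <;> nlinarith
      simp [this]
  refine ⟨f, ε, hfacet, (mem_facetCone_iff hd).2 ⟨fun j => |c (f j)|, hcpos, ?_, ?_⟩⟩
  · rwa [sum_eq_sum_orderEmbedding f fun i hi => by rw [hc0 i hi, abs_zero]] at hc1
  · rw [← hcx, sum_eq_sum_orderEmbedding f fun i hi => by rw [hc0 i hi, zero_smul]]
    refine Finset.sum_congr rfl fun j _ => ?_
    rw [signedPoint, smul_smul, mul_comm, ← hε j]

open Classical in
theorem volume_convexHull_eq_sum {X : Fin n → E3} (hX : IsGenericConfig X) :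
    volume (convexHull ℝ (range X ∪ -range X)) =
      ∑ p : (Fin 3 ↪o Fin n) × (Fin 3 → Bool),
        if IsHullFacet X p.1 p.2 then ENNReal.ofReal (|facetDet X p.1 p.2| / 6) else 0 := by
  set A : (Fin 3 ↪o Fin n) × (Fin 3 → Bool) → Set E3 := fun p =>
    if IsHullFacet X p.1 p.2 then facetCone X p.1 p.2 else ∅ with hA
  have hvol : ∀ p, volume (A p) =
      if IsHullFacet X p.1 p.2 then ENNReal.ofReal (|facetDet X p.1 p.2| / 6) else 0 := by
    intro p
    simp only [hA]
    split_ifs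
    · exact volume_coneSimplex _ _ _
    · simp
  have hmeas : ∀ p, MeasurableSet (A p) := by
    intro p
    simp only [hA]
    split_ifs
    · exact measurableSet_coneSimplex _ _ _
    · exact MeasurableSet.empty
  have hdisj : Pairwise (Function.onFun Disjoint A) := by
    intro p q hpq
    rw [Function.onFun, Set.disjoint_left]
    intro x hxp hxq
    simp only [hA] at hxp hxq
    split_ifs at hxp hxq with h1 h2
    · exact hpq (Prod.ext_iff.2 (eq_of_mem_facetCone hX h1 h2 hxp hxq))
    all_goals simp_all
  have hae : convexHull ℝ (range X ∪ -range X) =ᵐ[volume] ⋃ p, A p := by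
    have hnull : ∀ᵐ x : E3, ∀ S : Set (Fin n), Submodule.span ℝ (X '' S) ≠ ⊤ →
        x ∉ Submodule.span ℝ (X '' S) := by
      rw [ae_all_iff]
      intro S
      by_cases h : Submodule.span ℝ (X '' S) = ⊤
      · simp [h]
      · filter_upwards [measure_eq_zero_iff_ae_notMem.1 (Measure.addHaar_submodule volume _ h)]
          with x hx _ using hx
    filter_upwards [hnull] with x hx
    apply propext
    constructor
    · intro hxK
      obtain ⟨f, ε, h1, h2⟩ := exists_isHullFacet_mem hX hxK hx
      exact mem_iUnion.2 ⟨(f, ε), by simpa [hA, h1] using h2⟩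
    · intro hxU
      obtain ⟨p, hp⟩ := mem_iUnion.1 hxU
      simp only [hA] at hp
      split_ifs at hp
      · exact facetCone_subset_convexHull _ _ _ hp
      · simp at hp
  rw [measure_congr hae, measure_iUnion hdisj hmeas, tsum_fintype]
  exact Finset.sum_congr rfl fun p _ => hvol p

theorem measurePreserving_boolSign_smul (s : Bool) :
    MeasurePreserving (fun x : E3 => boolSign s • x) sphereUniform sphereUniform := by
  cases s
  · have := measurePreserving_sphereUniform (LinearIsometryEquiv.neg ℝ)
    convert this using 1
    ext1 x
    simp [boolSign]
  · convert MeasurePreserving.id sphereUniform using 1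
    ext1 x
    simp [boolSign]

theorem measurePreserving_comp_orderEmbedding {α : Type*} [MeasurableSpace α] (μ : Measure α)
    [SigmaFinite μ] (f : Fin 3 ↪o Fin n) :
    MeasurePreserving
      (fun X : Fin n → α => ((fun j => X (f j)), fun l : {l // l ∉ range f} => X l))
      (Measure.pi fun _ => μ) ((Measure.pi fun _ => μ).prod (Measure.pi fun _ => μ)) := by
  classical
  let _ : Fintype {l // l ∈ range f} := Subtype.fintype _
  have h1 := measurePreserving_piEquivPiSubtypeProd (fun _ : Fin n => μ) (fun l => l ∈ range f)
  have h2 := measurePreserving_arrowCongr' (fun _ : {l // l ∈ range f} => μ)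
    (fun _ : Fin 3 => μ) (Equiv.ofInjective f f.injective).symm (MeasurableEquiv.refl α)
    (fun _ => MeasurePreserving.id μ)
  exact (h2.prod (MeasurePreserving.id (Measure.pi fun _ : {l // l ∉ range f} => μ))).comp h1

theorem measurePreserving_signedPoint (f : Fin 3 ↪o Fin n) (ε : Fin 3 → Bool) :
    MeasurePreserving
      (fun X : Fin n → E3 => (signedPoint X f ε, fun l : {l // l ∉ range f} => X l))
      (Measure.pi fun _ => sphereUniform)
      ((Measure.pi fun _ => sphereUniform).prod (Measure.pi fun _ => sphereUniform)) :=
  ((measurePreserving_pi (fun _ : Fin 3 => sphereUniform) (fun _ : Fin 3 => sphereUniform)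
    fun j => measurePreserving_boolSign_smul (ε j)).prod
      (MeasurePreserving.id _)).comp (measurePreserving_comp_orderEmbedding sphereUniform f)

theorem ae_isGenericConfig :
    ∀ᵐ X ∂(Measure.pi fun _ : Fin n => sphereUniform), IsGenericConfig X := by
  simp only [IsGenericConfig, ae_all_iff]
  intro f ε l hl
  set B : Set ((Fin 3 → E3) × ({l // l ∉ range f} → E3)) :=
    {z | det3 (z.1 0) (z.1 1) (z.1 2) ≠ 0 ∧
      |inner ℝ (planeNormal (z.1 0) (z.1 1) (z.1 2)) (z.2 ⟨l, hl⟩)| =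
        |det3 (z.1 0) (z.1 1) (z.1 2)|} with hB
  have hdm : Measurable fun z : (Fin 3 → E3) × ({l // l ∉ range f} → E3) =>
      det3 (z.1 0) (z.1 1) (z.1 2) := measurable_det3 (by fun_prop) (by fun_prop) (by fun_prop)
  have hNm : Measurable fun z : (Fin 3 → E3) × ({l // l ∉ range f} → E3) =>
      planeNormal (z.1 0) (z.1 1) (z.1 2) :=
    measurable_planeNormal (by fun_prop) (by fun_prop) (by fun_prop)
  have hlm : Measurable fun z : (Fin 3 → E3) × ({l // l ∉ range f} → E3) => z.2 ⟨l, hl⟩ := by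
    fun_prop
  have hBm : MeasurableSet B :=
    (measurableSet_eq_fun hdm measurable_const).compl.inter
      (measurableSet_eq_fun (continuous_abs.measurable.comp (hNm.inner hlm))
        (continuous_abs.measurable.comp hdm))
  have hB0 : ((Measure.pi fun _ : Fin 3 => sphereUniform).prod
      (Measure.pi fun _ : {l // l ∉ range f} => sphereUniform)) B = 0 := by
    rw [Measure.measure_prod_null hBm]
    refine ae_of_all _ fun v => ?_
    by_cases hd : det3 (v 0) (v 1) (v 2) = 0
    · have : Prod.mk v ⁻¹' B = ∅ := by
        ext Z
        simp [hB, hd]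
      simp [this]
    · have hsub : Prod.mk v ⁻¹' B ⊆ Function.eval (⟨l, hl⟩ : {l // l ∉ range f}) ⁻¹'
          {x | |inner ℝ (planeNormal (v 0) (v 1) (v 2)) x| = |det3 (v 0) (v 1) (v 2)|} :=
        fun Z hZ => hZ.2
      have hm : MeasurableSet {x : E3 | |inner ℝ (planeNormal (v 0) (v 1) (v 2)) x| =
          |det3 (v 0) (v 1) (v 2)|} :=
        measurableSet_eq_fun (continuous_abs.measurable.comp (by fun_prop)) measurable_const
      refine measure_mono_null hsub ?_
      rw [(measurePreserving_eval (fun _ : {l // l ∉ range f} => sphereUniform)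
        ⟨l, hl⟩).measure_preimage hm.nullMeasurableSet]
      exact sphereUniform_abs_inner_eq (planeNormal_ne_zero hd) _
  rw [measure_eq_zero_iff_ae_notMem] at hB0
  filter_upwards [(measurePreserving_signedPoint f ε).quasiMeasurePreserving.ae hB0] with X hX hd h
  exact hX ⟨hd, h⟩

theorem card_compl_range (f : Fin 3 ↪o Fin n) :
    Fintype.card {l // l ∉ range f} = n - 3 := by
  classical
  rw [Fintype.card_subtype_compl, Fintype.card_fin]
  congr 1
  have := Set.card_range_of_injective f.injective
  rw [Fintype.card_fin] at this
  convert this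

/-- The set of configurations, split into three signed points and the remaining points, for which
the signed points span a facet. -/
def facetSet (ι : Type*) : Set ((Fin 3 → E3) × (ι → E3)) :=
  {z | ∀ l, |inner ℝ (planeNormal (z.1 0) (z.1 1) (z.1 2)) (z.2 l)| ≤
    |det3 (z.1 0) (z.1 1) (z.1 2)|}

theorem measurable_det3_fst (ι : Type*) : Measurable fun z : (Fin 3 → E3) × (ι → E3) =>
    |det3 (z.1 0) (z.1 1) (z.1 2)| :=
  continuous_abs.measurable.comp (measurable_det3 (by fun_prop) (by fun_prop) (by fun_prop))

theorem measurableSet_facetSet (ι : Type*) [Countable ι] : MeasurableSet (facetSet ι) := by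
  rw [facetSet, ofPred_forall]
  refine MeasurableSet.iInter fun l => measurableSet_le ?_ (measurable_det3_fst ι)
  have hN : Measurable fun z : (Fin 3 → E3) × (ι → E3) => planeNormal (z.1 0) (z.1 1) (z.1 2) :=
    measurable_planeNormal (by fun_prop) (by fun_prop) (by fun_prop)
  have hl : Measurable fun z : (Fin 3 → E3) × (ι → E3) => z.2 l := by fun_prop
  exact continuous_abs.measurable.comp (hN.inner hl)

/-- The contribution of a facet to the volume, in split coordinates. -/
noncomputable def facetWeight (ι : Type*) : (Fin 3 → E3) × (ι → E3) → ℝ≥0∞ :=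
  (facetSet ι).indicator fun z => ENNReal.ofReal (|det3 (z.1 0) (z.1 1) (z.1 2)| / 6)

theorem measurable_facetWeight (ι : Type*) [Countable ι] : Measurable (facetWeight ι) :=
  ((measurable_det3_fst ι).div_const 6).ennreal_ofReal.indicator (measurableSet_facetSet ι)

open Classical in
theorem ite_isHullFacet_eq_facetWeight (f : Fin 3 ↪o Fin n) (ε : Fin 3 → Bool)
    (X : Fin n → E3) :
    (if IsHullFacet X f ε then ENNReal.ofReal (|facetDet X f ε| / 6) else 0) =
      facetWeight {l // l ∉ range f} (signedPoint X f ε, fun l => X l) := by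
  have : IsHullFacet X f ε ↔
      (signedPoint X f ε, fun l : {l // l ∉ range f} => X l) ∈ facetSet {l // l ∉ range f} := by
    simp only [IsHullFacet, facetSet, mem_ofPred_eq, Subtype.forall]
    rfl
  rw [facetWeight, indicator_apply, if_congr this rfl rfl]
  rfl

theorem lintegral_facetWeight_right (ι : Type*) [Fintype ι] {v : Fin 3 → E3} (hv : ‖v 0‖ = 1) :
    ∫⁻ Z, facetWeight ι (v, Z) ∂(Measure.pi fun _ : ι => sphereUniform) =
      ENNReal.ofReal (1 / 6) * hullWeight (Fintype.card ι) (v 0) (v 1) (v 2) := by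
  set A : Set E3 := {x | |inner ℝ (planeNormal (v 0) (v 1) (v 2)) x| ≤ |det3 (v 0) (v 1) (v 2)|}
    with hA
  have hAm : MeasurableSet A :=
    measurableSet_le (continuous_abs.measurable.comp (by fun_prop)) measurable_const
  have h1 : ∀ Z, facetWeight ι (v, Z) = (Set.pi univ fun _ => A).indicator
      (fun _ => ENNReal.ofReal (|det3 (v 0) (v 1) (v 2)| / 6)) Z := by
    intro Z
    have : (v, Z) ∈ facetSet ι ↔ Z ∈ Set.pi univ fun _ => A := by
      simp [facetSet, hA]
    by_cases h : (v, Z) ∈ facetSet ι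
    · rw [facetWeight, indicator_of_mem h, indicator_of_mem (this.1 h)]
    · rw [facetWeight, indicator_of_notMem h, indicator_of_notMem (mt this.2 h)]
  simp only [h1]
  rw [lintegral_indicator_const (MeasurableSet.univ_pi fun _ => hAm), Measure.pi_pi,
    Finset.prod_const, Finset.card_univ]
  rcases eq_or_ne (det3 (v 0) (v 1) (v 2)) 0 with hd | hd
  · simp [hullWeight, hd]
  · rw [hA, sphereUniform_abs_inner_le (planeNormal_ne_zero hd) (abs_nonneg _)
      (abs_det3_le_norm_planeNormal hv _ _), hullWeight, ← ENNReal.ofReal_pow (by positivity),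
      ← ENNReal.ofReal_mul (by positivity), ← ENNReal.ofReal_mul (by positivity)]
    congr 1
    ring

theorem lintegral_facetWeight (ι : Type*) [Fintype ι] :
    ∫⁻ z, facetWeight ι z ∂((Measure.pi fun _ : Fin 3 => sphereUniform).prod
      (Measure.pi fun _ : ι => sphereUniform)) =
      ENNReal.ofReal (Real.pi / ((Fintype.card ι + 2) * (Fintype.card ι + 4) *
        (Fintype.card ι + 6))) := by
  have hm : Measurable fun v : Fin 3 → E3 =>
      hullWeight (Fintype.card ι) (v 0) (v 1) (v 2) :=
    measurable_hullWeight _ (by fun_prop) (by fun_prop) (by fun_prop)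
  have hnorm : ∀ᵐ v ∂(Measure.pi fun _ : Fin 3 => sphereUniform), ‖v 0‖ = 1 :=
    (measurePreserving_eval (fun _ : Fin 3 => sphereUniform) 0).quasiMeasurePreserving.ae
      ae_norm_eq_one_sphereUniform
  rw [lintegral_prod _ (measurable_facetWeight ι).aemeasurable]
  rw [lintegral_congr_ae (hnorm.mono fun v hv => lintegral_facetWeight_right ι hv),
    lintegral_const_mul _ hm, lintegral_pi_fin_three _ hm]
  have h := lintegral_hullWeight (Fintype.card ι)
  simp only [Matrix.cons_val_zero, Matrix.cons_val_one, Matrix.cons_val]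
  rw [h, ← ENNReal.ofReal_mul (by norm_num)]
  congr 1
  ring

theorem card_orderEmbedding_fin : Fintype.card (Fin 3 ↪o Fin n) = n.choose 3 := by
  rw [← Nat.card_eq_fintype_card, Nat.card_congr Set.powersetCard.ofFinEmbEquiv,
    Set.powersetCard.card, Nat.card_eq_fintype_card, Fintype.card_fin]

open Classical in
theorem lintegral_volume_convexHull :
    ∫⁻ X : Fin n → E3, ∑ p : (Fin 3 ↪o Fin n) × (Fin 3 → Bool),
        (if IsHullFacet X p.1 p.2 then ENNReal.ofReal (|facetDet X p.1 p.2| / 6) else 0)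
        ∂(Measure.pi fun _ => sphereUniform) =
      (n.choose 3 * 8 : ℕ) * ENNReal.ofReal (Real.pi / (((n - 3 : ℕ) + 2) * ((n - 3 : ℕ) + 4) *
        ((n - 3 : ℕ) + 6))) := by
  simp only [ite_isHullFacet_eq_facetWeight]
  rw [lintegral_finsetSum]
  · have h : ∀ p : (Fin 3 ↪o Fin n) × (Fin 3 → Bool),
        ∫⁻ X : Fin n → E3, facetWeight {l // l ∉ range p.1} (signedPoint X p.1 p.2, fun l => X l)
          ∂(Measure.pi fun _ => sphereUniform) =
        ENNReal.ofReal (Real.pi / (((n - 3 : ℕ) + 2) * ((n - 3 : ℕ) + 4) *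
          ((n - 3 : ℕ) + 6))) := by
      intro p
      rw [(measurePreserving_signedPoint p.1 p.2).lintegral_comp (measurable_facetWeight _),
        lintegral_facetWeight, card_compl_range]
    simp only [h]
    rw [Finset.sum_const, Finset.card_univ, Fintype.card_prod, card_orderEmbedding_fin,
      nsmul_eq_mul]
    simp
  · exact fun p _ => (measurable_facetWeight _).comp
      (measurePreserving_signedPoint p.1 p.2).measurable

theorem integral_volume_convexHull (hn : 2 ≤ n) :
    ∫ X : Fin n → E3, (volume (convexHull ℝ (range X ∪ -range X))).toReal
        ∂(Measure.pi fun _ => sphereUniform) =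
      (4 * Real.pi / 3) * ((n : ℝ) * ((n : ℝ) - 2)) / (((n : ℝ) + 1) * ((n : ℝ) + 3)) := by
  classical
  rw [integral_congr_ae (ae_isGenericConfig.mono fun X hX => by
    rw [volume_convexHull_eq_sum hX]), integral_toReal, lintegral_volume_convexHull]
  · rcases hn.eq_or_lt with rfl | hn
    · simp
    obtain ⟨k, rfl⟩ := Nat.exists_eq_add_of_le (show 3 ≤ n from hn)
    have hc : ((3 + k).choose 3 : ℝ) = (k + 3) * (k + 2) * (k + 1) / 6 := by
      rw [Nat.cast_add_choose, add_comm 3 k]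
      simp only [Nat.factorial_succ, Nat.factorial_zero]
      have := Nat.factorial_ne_zero k
      push_cast
      field_simp
      ring
    rw [ENNReal.toReal_mul, ENNReal.toReal_natCast, ENNReal.toReal_ofReal (by positivity),
      Nat.add_sub_cancel_left, Nat.cast_mul, hc]
    have h4 : (3 : ℝ) + k + 1 ≠ 0 := by positivity
    have h6 : (3 : ℝ) + k + 3 ≠ 0 := by positivity
    push_cast
    field_simp
    ring
  · simp only [ite_isHullFacet_eq_facetWeight]
    exact (Finset.measurable_fun_sum _ fun p _ => (measurable_facetWeight _).comp
      (measurePreserving_signedPoint p.1 p.2).measurable).aemeasurable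
  · refine ae_of_all _ fun X => ENNReal.sum_lt_top.2 fun p _ => ?_
    split_ifs <;> simp

end

/-- Expected volume of the symmetric convex hull of `n` i.i.d. uniform points on the unit
sphere in `ℝ³`. -/
theorem expected_volume_sphere_symmetric_hull (n : ℕ) (hn : 2 ≤ n) :
    let σ : Measure (EuclideanSpace ℝ (Fin 3)) :=
      (μH[2] : Measure (EuclideanSpace ℝ (Fin 3))).restrict (Metric.sphere 0 1)
    let μ : Measure (EuclideanSpace ℝ (Fin 3)) := (σ Set.univ)⁻¹ • σ
    (∫ X : Fin n → EuclideanSpace ℝ (Fin 3),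
        (volume (convexHull ℝ (Set.range X ∪ -Set.range X))).toReal ∂(Measure.pi fun _ => μ))
      = (4 * Real.pi / 3) * ((n : ℝ) * ((n : ℝ) - 2)) / (((n : ℝ) + 1) * ((n : ℝ) + 3)) := by
  intro σ μ
  exact integral_volume_convexHull hn
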